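/- Let c > 0, s ∈ (0, 2/3) and δ > 0, and let l(x) = (1 − √(1−x))² for 0 ≤ x ≤ 1. Then, as n → ∞, the proportion of ν in Π(n, n, ⌊c·n^s⌋) such that every point P = (P₁,P₂) lying on one of the segments [V_{i−1}, V_i] joining consecutive vertices of the chain of ν satisfies |P₂ − n·l(P₁/n)| ≤ δ·n, tends to 1. (In other words, under the uniform measure on Π(n,n,⌊c n^s⌋), the rescaled chain concentrates in the δ-neighborhood of the arc of parabola √y = 1 − √(1−x).) -/

import Mathlib

open Real Filter Asymptotics

/-- The set of pairs of coprime nonnegative integers (including `(0,1)` and `(1,0)`). -/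
abbrev Xc : Type := {x : ℕ × ℕ // Nat.gcd x.1 x.2 = 1}

/-- The endpoint of the convex chain encoded by a finitely supported `ν : X →₀ ℕ`. -/
def chainEndpoint (ν : Xc →₀ ℕ) : ℕ × ℕ :=
  (ν.sum fun x m => m * x.val.1, ν.sum fun x m => m * x.val.2)

/-- `a` has strictly smaller slope than `b` (slope of `x` is `x₂/x₁`, with slope `∞` for `x₁ = 0`). -/
def slopeLt (a b : Xc) : Prop := a.val.2 * b.val.1 < b.val.2 * a.val.1

/-- `xs` is the support of `ν` listed in increasing order of slope. -/
def SortedSupport (ν : Xc →₀ ℕ) (xs : List Xc) : Prop :=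
  xs.toFinset = ν.support ∧ xs.Chain' slopeLt

/-- The vertex `V_i` of the chain of `ν` (as a point of `ℝ²`): the partial sum
`∑_{j ≤ i} ν(x⁽ʲ⁾)·x⁽ʲ⁾` over the first `i` elements of the sorted support `xs`. -/
noncomputable def vertexR (ν : Xc →₀ ℕ) (xs : List Xc) (i : ℕ) : ℝ × ℝ :=
  (((xs.take i).map fun x => ((ν x * x.val.1 : ℕ) : ℝ)).sum,
   ((xs.take i).map fun x => ((ν x * x.val.2 : ℕ) : ℝ)).sum)

/-- The parabola `y = l(x) = (1 − √(1−x))²`, i.e. `√y = 1 − √(1−x)`. -/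
noncomputable def parab (x : ℝ) : ℝ := (1 - Real.sqrt (1 - x)) ^ 2

/-- The chain of `ν` lies in the `δ,n`-neighborhood of the parabola: every point `P` on one
of the segments joining consecutive vertices satisfies `|P₂ − n·l(P₁/n)| ≤ δ·n`. -/
def GoodParab (n : ℕ) (δ : ℝ) (ν : Xc →₀ ℕ) : Prop :=
  ∀ xs : List Xc, SortedSupport ν xs →
    ∀ i < xs.length, ∀ P ∈ segment ℝ (vertexR ν xs i) (vertexR ν xs (i + 1)),
      |P.2 - (n : ℝ) * parab (P.1 / n)| ≤ δ * n

/-- The geometric weight `exp (-h (v₁ + v₂))` of a lattice vector `v`. -/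
noncomputable def geomWeight (h : ℝ) (v : ℕ × ℕ) : ℝ := exp (-h * (v.1 + v.2))

/-- The total geometric weight of all lattice vectors. -/
noncomputable def totalWeight (h : ℝ) : ℝ := ∑' v, geomWeight h v

lemma geomWeight_pos (h : ℝ) (v : ℕ × ℕ) : 0 < geomWeight h v := exp_pos _

lemma geomWeight_le_one {h : ℝ} (hh : 0 ≤ h) (v : ℕ × ℕ) : geomWeight h v ≤ 1 := by
  unfold geomWeight
  rw [exp_le_one_iff]
  nlinarith [mul_nonneg hh (by positivity : (0 : ℝ) ≤ v.1 + v.2)]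

lemma geomWeight_eq_pow (h : ℝ) (v : ℕ × ℕ) :
    geomWeight h v = exp (-h) ^ v.1 * exp (-h) ^ v.2 := by
  unfold geomWeight
  rw [← exp_nat_mul, ← exp_nat_mul, ← exp_add]
  ring_nf

lemma exp_neg_lt_one {h : ℝ} (hh : 0 < h) : exp (-h) < 1 := by
  rw [exp_lt_one_iff]; linarith

lemma hasSum_geomWeight {h : ℝ} (hh : 0 < h) :
    HasSum (geomWeight h) ((1 - exp (-h))⁻¹ * (1 - exp (-h))⁻¹) := by
  have h1 := hasSum_geometric_of_lt_one (exp_pos (-h)).le (exp_neg_lt_one hh)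
  have h2 := h1.mul h1 (h1.summable.mul_of_nonneg h1.summable
    (fun n => by positivity) (fun n => by positivity))
  refine h2.congr_fun ?_
  intro v
  exact geomWeight_eq_pow h v

lemma summable_geomWeight {h : ℝ} (hh : 0 < h) : Summable (geomWeight h) :=
  (hasSum_geomWeight hh).summable

lemma totalWeight_eq {h : ℝ} (hh : 0 < h) :
    totalWeight h = (1 - exp (-h))⁻¹ * (1 - exp (-h))⁻¹ :=
  (hasSum_geomWeight hh).tsum_eq

lemma totalWeight_pos {h : ℝ} (hh : 0 < h) : 0 < totalWeight h := by
  rw [totalWeight_eq hh]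
  have := exp_neg_lt_one hh
  have : 0 < 1 - exp (-h) := by linarith
  positivity

lemma totalWeight_ge {h : ℝ} (hh : 0 < h) : 1 / h ^ 2 ≤ totalWeight h := by
  rw [totalWeight_eq hh]
  have h1 := exp_neg_lt_one hh
  have h2 : 1 - exp (-h) ≤ h := by linarith [add_one_le_exp (-h)]
  have h3 : h⁻¹ ≤ (1 - exp (-h))⁻¹ := inv_anti₀ (by linarith) h2
  have : 1 / h ^ 2 = h⁻¹ * h⁻¹ := by field_simp
  rw [this]
  gcongr

lemma totalWeight_le {h : ℝ} (hh : 0 < h) (hh1 : h ≤ 1) : totalWeight h ≤ 4 / h ^ 2 := by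
  rw [totalWeight_eq hh]
  have h2 : h / 2 ≤ 1 - exp (-h) := by
    have h3 := quadratic_le_exp_of_nonneg hh.le
    have h4 : exp (-h) * exp h = 1 := by rw [← exp_add]; simp
    have h5 := exp_pos (-h)
    nlinarith
  have h3 : (1 - exp (-h))⁻¹ ≤ (h / 2)⁻¹ := inv_anti₀ (by linarith) h2
  have h6 : 0 ≤ (1 - exp (-h))⁻¹ := inv_nonneg.2 (by linarith)
  calc _ ≤ (h / 2)⁻¹ * (h / 2)⁻¹ := by gcongr
    _ = _ := by field_simp; norm_num

lemma totalWeight_half_le {h : ℝ} (hh : 0 < h) : totalWeight (h / 2) ≤ 4 * totalWeight h := by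
  rw [totalWeight_eq hh, totalWeight_eq (half_pos hh)]
  have h1 := exp_neg_lt_one (half_pos hh)
  set x := exp (-(h / 2)) with hx
  have h2 : exp (-h) = x * x := by rw [hx, ← exp_add]; ring_nf
  have h0 : 0 < x := exp_pos _
  rw [h2]
  have h3 : (1 - x)⁻¹ ≤ 2 * (1 - x * x)⁻¹ := by
    have : 0 < 1 - x := by linarith
    have e : 1 - x * x = (1 - x) * (1 + x) := by ring
    rw [e, mul_inv, ← div_eq_mul_inv, ← mul_div_assoc, le_div_iff₀ (by linarith)]
    have : 0 < (1 - x)⁻¹ := by positivity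
    nlinarith
  have h6 : 0 ≤ (1 - x)⁻¹ := inv_nonneg.2 (by linarith)
  calc _ ≤ (2 * (1 - x * x)⁻¹) * (2 * (1 - x * x)⁻¹) :=
        mul_le_mul h3 h3 h6 (h6.trans h3)
    _ = _ := by ring

lemma exp_le_one_add_add_sq_mul_exp_abs (y : ℝ) : exp y ≤ 1 + y + y ^ 2 * exp |y| := by
  have h := Complex.norm_exp_sub_sum_le_norm_mul_exp (y : ℂ) 2
  simp only [Finset.sum_range_succ, Finset.sum_range_zero] at h
  have h' : |exp y - (1 + y)| ≤ |y| ^ 2 * exp |y| := by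
    have h1 := h
    norm_num at h1
    have e2 : Complex.exp y - (1 + y) = ((exp y - (1 + y) : ℝ) : ℂ) := by push_cast; ring
    rw [e2, Complex.norm_real] at h1
    simpa using h1
  rw [sq_abs] at h'
  linarith [le_abs_self (exp y - (1 + y))]

/-- `f` is dominated by the rescaled size of a lattice vector, and its mean under the geometric
weight of parameter `h` tends to `μ` as `h → 0⁺`. -/
structure HasGeomMean (f : ℝ → ℕ × ℕ → ℝ) (μ : ℝ) : Prop where
  abs_le : ∀ h, 0 < h → ∀ v : ℕ × ℕ, |f h v| ≤ h * (v.1 + v.2)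
  tendsto : Tendsto (fun h => (∑' v, geomWeight h v * f h v) / totalWeight h)
    (nhdsWithin 0 (Set.Ioi 0)) (nhds μ)

lemma HasGeomMean.neg {f : ℝ → ℕ × ℕ → ℝ} {μ : ℝ} (hf : HasGeomMean f μ) :
    HasGeomMean (fun h v => -f h v) (-μ) where
  abs_le h hh v := by simpa using hf.abs_le h hh v
  tendsto := by
    refine hf.tendsto.neg.congr fun h => ?_
    simp only [mul_neg, tsum_neg, neg_div]

lemma sq_mul_exp_le {l X : ℝ} (hl1 : l ≤ 1 / 4) (hX : 0 ≤ X) :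
    X ^ 2 * exp (l * X) ≤ 32 * exp (X / 2) := by
  have h1 := quadratic_le_exp_of_nonneg (show 0 ≤ X / 4 by positivity)
  have h2 : X ^ 2 ≤ 32 * exp (X / 4) := by nlinarith
  have h3 : exp (l * X) ≤ exp (X / 4) := exp_le_exp.2 (by nlinarith)
  calc _ ≤ (32 * exp (X / 4)) * exp (X / 4) := by gcongr
    _ = 32 * exp (X / 2) := by rw [mul_assoc, ← exp_add]; ring_nf

lemma summable_geomWeight_mul {h : ℝ} (hh : 0 < h) {f : ℕ × ℕ → ℝ}
    (hf : ∀ v : ℕ × ℕ, |f v| ≤ h * (v.1 + v.2)) : Summable fun v => geomWeight h v * f v := by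
  refine Summable.of_norm_bounded (g := fun v => 32 * geomWeight (h / 2) v)
    ((summable_geomWeight (half_pos hh)).mul_left 32) fun v => ?_
  have hX : 0 ≤ h * ((v.1 : ℝ) + v.2) := by positivity
  have h1 : |f v| ≤ 32 * exp (h * ((v.1 : ℝ) + v.2) / 2) := by
    have := quadratic_le_exp_of_nonneg (show 0 ≤ h * ((v.1 : ℝ) + v.2) / 2 by positivity)
    have := hf v
    nlinarith [sq_nonneg (h * ((v.1 : ℝ) + v.2))]
  rw [norm_mul, Real.norm_eq_abs, Real.norm_eq_abs, abs_of_pos (geomWeight_pos h v)]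
  calc _ ≤ geomWeight h v * (32 * exp (h * ((v.1 : ℝ) + v.2) / 2)) := by
        have := geomWeight_pos h v
        gcongr
    _ = _ := by
        unfold geomWeight
        rw [mul_left_comm, ← exp_add]
        ring_nf

lemma geomWeight_mul_exp_le {h l : ℝ} (hh : 0 < h) (hl0 : 0 ≤ l) (hl : l ≤ 1 / 4) {f : ℕ × ℕ → ℝ}
    (hf : ∀ v : ℕ × ℕ, |f v| ≤ h * (v.1 + v.2)) (v : ℕ × ℕ) :
    geomWeight h v * exp (l * f v) ≤
      geomWeight h v + l * (geomWeight h v * f v) + 32 * l ^ 2 * geomWeight (h / 2) v := by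
  set X := h * ((v.1 : ℝ) + v.2) with hX
  have hX0 : 0 ≤ X := by positivity
  have h1 := exp_le_one_add_add_sq_mul_exp_abs (l * f v)
  have h2 : (l * f v) ^ 2 * exp |l * f v| ≤ l ^ 2 * (32 * exp (X / 2)) := by
    have h3 : |l * f v| ≤ l * X := by
      rw [abs_mul, abs_of_nonneg hl0]
      exact mul_le_mul_of_nonneg_left (hf v) hl0
    calc (l * f v) ^ 2 * exp |l * f v| = |l * f v| ^ 2 * exp |l * f v| := by rw [sq_abs]
      _ ≤ (l * X) ^ 2 * exp (l * X) := by gcongr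
      _ = l ^ 2 * (X ^ 2 * exp (l * X)) := by ring
      _ ≤ _ := mul_le_mul_of_nonneg_left (sq_mul_exp_le hl hX0) (sq_nonneg l)
  have h4 : geomWeight (h / 2) v = geomWeight h v * exp (X / 2) := by
    unfold geomWeight
    rw [← exp_add, hX]
    ring_nf
  have h5 := geomWeight_pos h v
  rw [h4]
  calc _ ≤ geomWeight h v * (1 + l * f v + l ^ 2 * (32 * exp (X / 2))) := by gcongr; linarith
    _ = _ := by ring

lemma sum_prod_le_tsum_pow {α : Type*} {g : α → ℝ} (hg : ∀ v, 0 ≤ g v) (hs : Summable g) (k : ℕ)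
    (T : Finset (Fin k → α)) : ∑ v ∈ T, ∏ i, g (v i) ≤ (∑' v, g v) ^ k := by
  classical
  set B : Finset α := T.biUnion fun v => Finset.univ.image v with hB
  have hT : T ⊆ Fintype.piFinset fun _ => B := by
    intro v hv
    rw [Fintype.mem_piFinset]
    intro i
    rw [hB, Finset.mem_biUnion]
    exact ⟨v, hv, Finset.mem_image_of_mem _ (Finset.mem_univ _)⟩
  calc _ ≤ ∑ v ∈ Fintype.piFinset fun _ : Fin k => B, ∏ i, g (v i) :=
        Finset.sum_le_sum_of_subset_of_nonneg hT fun v _ _ => Finset.prod_nonneg fun i _ => hg _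
    _ = (∑ v ∈ B, g v) ^ k := by
        rw [Finset.sum_prod_piFinset B fun _ => g]
        simp
    _ ≤ _ := by
        have : 0 ≤ ∑ v ∈ B, g v := Finset.sum_nonneg fun v _ => hg v
        gcongr
        exact hs.sum_le_tsum B fun v _ => hg v

/-- Exponential upper tail bound for sums of i.i.d. functionals of geometric vectors. -/
lemma HasGeomMean.upper_tail {f : ℝ → ℕ × ℕ → ℝ} {μ : ℝ} (hf : HasGeomMean f μ) {ε : ℝ}
    (hε : 0 < ε) : ∃ c > 0, ∃ h₀ > 0, ∀ h, 0 < h → h < h₀ → ∀ (k : ℕ)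
      (T : Finset (Fin k → ℕ × ℕ)), (∀ v ∈ T, k * (μ + ε) ≤ ∑ i, f h (v i)) →
      ∑ v ∈ T, ∏ i, geomWeight h (v i) ≤ exp (-c * k) * totalWeight h ^ k := by
  set l : ℝ := min (1 / 4) (ε / 512) with hl
  have hl0 : 0 < l := by positivity
  have hl1 : l ≤ 1 / 4 := min_le_left _ _
  have hl2 : l ≤ ε / 512 := min_le_right _ _
  have hev := hf.tendsto.eventually (gt_mem_nhds (show μ < μ + ε / 4 by linarith))
  rw [eventually_nhdsWithin_iff, Metric.eventually_nhds_iff] at hev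
  obtain ⟨h₀, hh₀, hev⟩ := hev
  refine ⟨l * ε / 2, by positivity, h₀, hh₀, fun h hh hlt k T hT => ?_⟩
  have hm := hev (y := h) (by simpa [abs_of_pos hh] using hlt) hh
  have hS := totalWeight_pos hh
  rw [div_lt_iff₀ hS] at hm
  set g : ℕ × ℕ → ℝ := fun v => geomWeight h v * exp (l * f h v) with hg
  have hg0 : ∀ v, 0 ≤ g v := fun v => (mul_pos (geomWeight_pos h v) (exp_pos _)).le
  have hsum1 := summable_geomWeight_mul hh (hf.abs_le h hh)
  have hsumB : Summable fun v => geomWeight h v + l * (geomWeight h v * f h v)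
      + 32 * l ^ 2 * geomWeight (h / 2) v :=
    ((summable_geomWeight hh).add (hsum1.mul_left l)).add
      ((summable_geomWeight (half_pos hh)).mul_left _)
  have hle := geomWeight_mul_exp_le hh hl0.le hl1 (hf.abs_le h hh)
  have hgs : Summable g := Summable.of_nonneg_of_le hg0 hle hsumB
  have htg : ∑' v, g v ≤ totalWeight h * exp (l * (μ + ε / 2)) := by
    calc ∑' v, g v ≤ ∑' v, (geomWeight h v + l * (geomWeight h v * f h v)
          + 32 * l ^ 2 * geomWeight (h / 2) v) := hgs.tsum_le_tsum hle hsumB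
      _ = totalWeight h + l * (∑' v, geomWeight h v * f h v)
          + 32 * l ^ 2 * totalWeight (h / 2) := by
        rw [Summable.tsum_add ((summable_geomWeight hh).add (hsum1.mul_left l))
          ((summable_geomWeight (half_pos hh)).mul_left _),
          Summable.tsum_add (summable_geomWeight hh) (hsum1.mul_left l), tsum_mul_left,
          tsum_mul_left]
        rfl
      _ ≤ totalWeight h + l * ((μ + ε / 4) * totalWeight h)
          + 32 * l ^ 2 * (4 * totalWeight h) := by
        gcongr
        exact totalWeight_half_le hh
      _ ≤ totalWeight h * (l * (μ + ε / 2) + 1) := by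
        have : l * l ≤ l * (ε / 512) := by gcongr
        nlinarith
      _ ≤ _ := by gcongr; exact add_one_le_exp _
  have htg0 : 0 ≤ ∑' v, g v := tsum_nonneg hg0
  calc ∑ v ∈ T, ∏ i, geomWeight h (v i)
      ≤ ∑ v ∈ T, exp (-(l * (k * (μ + ε)))) * ∏ i, g (v i) := by
        refine Finset.sum_le_sum fun v hv => ?_
        rw [hg]
        simp only
        rw [Finset.prod_mul_distrib, ← exp_sum, ← Finset.mul_sum, mul_left_comm, ← exp_add]
        refine le_mul_of_one_le_right (Finset.prod_nonneg fun i _ => (geomWeight_pos _ _).le) ?_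
        rw [one_le_exp_iff]
        have := mul_le_mul_of_nonneg_left (hT v hv) hl0.le
        linarith
    _ = exp (-(l * (k * (μ + ε)))) * ∑ v ∈ T, ∏ i, g (v i) := by rw [Finset.mul_sum]
    _ ≤ exp (-(l * (k * (μ + ε)))) * (∑' v, g v) ^ k := by
        gcongr
        exact sum_prod_le_tsum_pow hg0 hgs k T
    _ ≤ exp (-(l * (k * (μ + ε)))) * (totalWeight h * exp (l * (μ + ε / 2))) ^ k := by gcongr
    _ = _ := by
        rw [mul_pow, ← exp_nat_mul, mul_left_comm, ← exp_add, mul_comm]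
        ring_nf

lemma hasSum_nat_mul_exp {a : ℝ} (ha : 0 < a) :
    HasSum (fun n : ℕ => (n : ℝ) * exp (-a) ^ n) (exp (-a) / (1 - exp (-a)) ^ 2) := by
  refine hasSum_coe_mul_geometric_of_norm_lt_one ?_
  rw [Real.norm_eq_abs, abs_of_pos (exp_pos _)]
  exact exp_neg_lt_one ha

lemma hasSum_mul_exp_prod {a h : ℝ} (ha : 0 < a) (hh : 0 < h) :
    HasSum (fun v : ℕ × ℕ => (v.2 : ℝ) * exp (-(a * v.2 + h * v.1)))
      (exp (-a) / (1 - exp (-a)) ^ 2 * (1 - exp (-h))⁻¹) := by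
  have h1 := hasSum_nat_mul_exp ha
  have h2 := hasSum_geometric_of_lt_one (exp_pos (-h)).le (exp_neg_lt_one hh)
  have h3 := h2.mul h1 (h2.summable.mul_of_nonneg h1.summable
    (fun n => by positivity) (fun n => by positivity))
  rw [mul_comm] at h3
  refine h3.congr_fun fun v => ?_
  rw [← exp_nat_mul, ← exp_nat_mul, mul_left_comm, ← exp_add]
  ring_nf

lemma tsum_geomWeight_shift {h : ℝ} (φ : ℕ → ℕ) :
    ∑' v : ℕ × ℕ, geomWeight h v * (h * v.2 * (if φ v.2 ≤ v.1 then 1 else 0)) =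
      ∑' v : ℕ × ℕ, h * ((v.2 : ℝ) * exp (-(h * (v.2 + φ v.2) + h * v.1))) := by
  have hinj : Function.Injective fun v : ℕ × ℕ => (v.1 + φ v.2, v.2) := by
    rintro ⟨a, b⟩ ⟨a', b'⟩ e
    simp only [Prod.mk.injEq] at e
    obtain ⟨e1, rfl⟩ := e
    simpa using e1
  rw [← hinj.tsum_eq]
  · refine tsum_congr fun v => ?_
    simp only [le_add_iff_nonneg_left, zero_le, if_true]
    unfold geomWeight
    push_cast
    rw [mul_one, mul_comm, mul_assoc]
    ring_nf
  · rintro ⟨a, b⟩ hv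
    simp only [Function.mem_support] at hv
    by_cases hb : φ b ≤ a
    · exact ⟨(a - φ b, b), by simp [Nat.sub_add_cancel hb]⟩
    · simp [hb] at hv

lemma tendsto_one_sub_exp_div (a : ℝ) :
    Tendsto (fun h => (1 - exp (-(a * h))) / h) (nhdsWithin 0 (Set.Ioi 0)) (nhds a) := by
  have h1 : HasDerivAt (fun h => 1 - exp (-(a * h))) a 0 := by
    have h2 : HasDerivAt (fun h : ℝ => -(a * h)) (-a) 0 := by
      simpa using (hasDerivAt_id (0 : ℝ)).const_mul (-a)
    have := (h2.exp).const_sub 1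
    simpa using this
  have h2 := h1.tendsto_slope_zero_right
  refine h2.congr fun h => ?_
  simp [div_eq_inv_mul]

lemma tendsto_exp_neg_mul (a : ℝ) :
    Tendsto (fun h => exp (-(a * h))) (nhdsWithin 0 (Set.Ioi 0)) (nhds 1) := by
  have : Continuous fun h : ℝ => exp (-(a * h)) := by fun_prop
  have h := this.tendsto 0
  simp only [mul_zero, neg_zero, exp_zero] at h
  exact h.mono_left nhdsWithin_le_nhds

lemma tendsto_mean_bound {u : ℝ} (hu : 0 < u) :
    Tendsto (fun h => h * (exp (-(u⁻¹ * h)) / (1 - exp (-(u⁻¹ * h))) ^ 2 * (1 - exp (-h))⁻¹)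
      / totalWeight h) (nhdsWithin 0 (Set.Ioi 0)) (nhds (u ^ 2)) := by
  have h1 := tendsto_one_sub_exp_div u⁻¹
  have h2 := tendsto_one_sub_exp_div 1
  have h3 := tendsto_exp_neg_mul u⁻¹
  have h4 := (h3.div (h1.pow 2) (by positivity)).mul h2
  have e : 1 / (u⁻¹) ^ 2 * 1 = u ^ 2 := by field_simp
  rw [e] at h4
  refine h4.congr' ?_
  filter_upwards [self_mem_nhdsWithin] with h hh
  have hh : 0 < h := hh
  rw [totalWeight_eq hh]
  have h5 := exp_neg_lt_one hh
  have h6 := exp_neg_lt_one (show 0 < u⁻¹ * h by positivity)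
  have h7 : 1 - exp (-h) ≠ 0 := by linarith
  have h8 : 1 - exp (-(u⁻¹ * h)) ≠ 0 := by linarith
  simp only [Pi.div_apply, one_mul]
  field_simp

lemma tendsto_mean_shift {u : ℝ} (hu : 0 < u) {φ : ℕ → ℕ}
    (hφ1 : ∀ b : ℕ, (1 - u) * b ≤ u * φ b) (hφ2 : ∀ b : ℕ, u * φ b ≤ (1 - u) * b + u) :
    Tendsto (fun h => (∑' v : ℕ × ℕ, geomWeight h v *
      (h * v.2 * (if φ v.2 ≤ v.1 then 1 else 0))) / totalWeight h)
      (nhdsWithin 0 (Set.Ioi 0)) (nhds (u ^ 2)) := by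
  have hup := tendsto_mean_bound hu
  have hlow := (tendsto_exp_neg_mul 1).mul hup
  rw [one_mul] at hlow
  have key : ∀ b : ℕ, u⁻¹ * (b : ℝ) ≤ b + φ b ∧ (b : ℝ) + φ b ≤ u⁻¹ * b + 1 := by
    intro b
    have := hφ1 b
    have := hφ2 b
    constructor
    · rw [inv_mul_le_iff₀ hu]; linarith
    · rw [← sub_le_iff_le_add, le_inv_mul_iff₀ hu]; linarith
  refine tendsto_of_tendsto_of_tendsto_of_le_of_le' hlow hup ?_ ?_
  all_goals
    filter_upwards [self_mem_nhdsWithin] with h hh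
    have hh : 0 < h := hh
    have hS := totalWeight_pos hh
    have hsum := hasSum_mul_exp_prod (a := u⁻¹ * h) (h := h) (by positivity) hh
    have hs1 : Summable fun v : ℕ × ℕ =>
        h * ((v.2 : ℝ) * exp (-(h * (v.2 + φ v.2) + h * v.1))) := by
      refine Summable.of_nonneg_of_le (fun v => by positivity) (fun v => ?_)
        (hsum.summable.mul_left h)
      have := (key v.2).1
      refine mul_le_mul_of_nonneg_left (mul_le_mul_of_nonneg_left (exp_le_exp.2 ?_)
        (by positivity)) hh.le
      nlinarith
    rw [tsum_geomWeight_shift]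
  · rw [← mul_div_assoc]
    gcongr
    rw [mul_left_comm, ← hsum.tsum_eq, ← tsum_mul_left, ← tsum_mul_left]
    refine Summable.tsum_le_tsum (fun v => ?_) ((hsum.summable.mul_left _).mul_left _) hs1
    rw [mul_left_comm (exp _), ← exp_add]
    have := (key v.2).2
    refine mul_le_mul_of_nonneg_left (mul_le_mul_of_nonneg_left (exp_le_exp.2 ?_)
      (by positivity)) hh.le
    nlinarith
  · gcongr
    rw [← hsum.tsum_eq, ← tsum_mul_left]
    refine Summable.tsum_le_tsum (fun v => ?_) hs1 (hsum.summable.mul_left _)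
    have := (key v.2).1
    refine mul_le_mul_of_nonneg_left (mul_le_mul_of_nonneg_left (exp_le_exp.2 ?_)
      (by positivity)) hh.le
    nlinarith

lemma tendsto_mean_snd_le {u : ℝ} (hu : 0 ≤ u) (hu1 : u ≤ 1) :
    Tendsto (fun h => (∑' v : ℕ × ℕ, geomWeight h v *
      (h * v.2 * (if (1 - u) * v.2 ≤ u * v.1 then 1 else 0))) / totalWeight h)
      (nhdsWithin 0 (Set.Ioi 0)) (nhds (u ^ 2)) := by
  rcases hu.eq_or_lt with rfl | hu
  · refine Tendsto.congr (f₁ := fun _ => 0) (fun h => ?_) (by simp)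
    have : ∀ v : ℕ × ℕ, geomWeight h v *
        (h * v.2 * (if (1 - 0 : ℝ) * v.2 ≤ 0 * v.1 then 1 else 0)) = 0 := by
      intro v
      split_ifs with hv
      · have : (v.2 : ℝ) = 0 := le_antisymm (by simpa using hv) (by positivity)
        simp [this]
      · simp
    simp_rw [this]
    simp
  have hk : 0 ≤ 1 - u := by linarith
  have h := tendsto_mean_shift hu (φ := fun b => ⌈(1 - u) * b / u⌉₊) (fun b => ?_) (fun b => ?_)
  · refine h.congr fun h => ?_
    simp_rw [Nat.ceil_le, div_le_iff₀' hu]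
  · have := Nat.le_ceil ((1 - u) * b / u)
    rwa [div_le_iff₀' hu] at this
  · have := (Nat.ceil_lt_add_one (show 0 ≤ (1 - u) * b / u by positivity)).le
    have := mul_le_mul_of_nonneg_left this hu.le
    rw [mul_add, mul_div_cancel₀ _ hu.ne'] at this
    linarith

lemma tendsto_mean_snd_lt {u : ℝ} (hu : 0 ≤ u) (hu1 : u ≤ 1) :
    Tendsto (fun h => (∑' v : ℕ × ℕ, geomWeight h v *
      (h * v.2 * (if (1 - u) * v.2 < u * v.1 then 1 else 0))) / totalWeight h)
      (nhdsWithin 0 (Set.Ioi 0)) (nhds (u ^ 2)) := by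
  rcases hu.eq_or_lt with rfl | hu
  · refine Tendsto.congr (f₁ := fun _ => 0) (fun h => ?_) (by simp)
    have : ∀ v : ℕ × ℕ, geomWeight h v *
        (h * v.2 * (if (1 - 0 : ℝ) * v.2 < 0 * v.1 then 1 else 0)) = 0 := by
      intro v
      rw [if_neg]
      · simp
      · simp
    simp_rw [this]
    simp
  have hk : 0 ≤ 1 - u := by linarith
  have h := tendsto_mean_shift hu (φ := fun b => ⌊(1 - u) * b / u⌋₊ + 1) (fun b => ?_)
    (fun b => ?_)
  · refine h.congr fun h => ?_
    have : ∀ v : ℕ × ℕ, (⌊(1 - u) * v.2 / u⌋₊ + 1 ≤ v.1) ↔ (1 - u) * v.2 < u * v.1 := by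
      intro v
      rw [Nat.add_one_le_iff, Nat.floor_lt (by positivity), div_lt_iff₀' hu]
    simp_rw [this]
  · have := (Nat.lt_floor_add_one ((1 - u) * b / u)).le
    rw [div_le_iff₀' hu] at this
    push_cast
    exact this
  · have := Nat.floor_le (show 0 ≤ (1 - u) * b / u by positivity)
    have := mul_le_mul_of_nonneg_left this hu.le
    rw [mul_div_cancel₀ _ hu.ne'] at this
    push_cast
    linarith

/-- The rescaled second coordinate of `v` if its slope is at most `u / (1 - u)`, and `0` otherwise. -/
noncomputable def sndBelow (u h : ℝ) (v : ℕ × ℕ) : ℝ :=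
  h * v.2 * (if (1 - u) * v.2 ≤ u * v.1 then 1 else 0)

/-- The rescaled first coordinate of `v` if its slope is at most `u / (1 - u)`, and `0` otherwise. -/
noncomputable def fstBelow (u h : ℝ) (v : ℕ × ℕ) : ℝ :=
  h * v.1 * (if (1 - u) * v.2 ≤ u * v.1 then 1 else 0)

lemma hasGeomMean_sndBelow {u : ℝ} (hu : 0 ≤ u) (hu1 : u ≤ 1) :
    HasGeomMean (sndBelow u) (u ^ 2) where
  abs_le h hh v := by
    unfold sndBelow
    split_ifs
    · rw [mul_one, abs_of_nonneg (by positivity)]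
      gcongr
      simp
    · simp only [mul_zero, abs_zero]; positivity
  tendsto := tendsto_mean_snd_le hu hu1

lemma hasGeomMean_fstBelow {u : ℝ} (hu : 0 ≤ u) (hu1 : u ≤ 1) :
    HasGeomMean (fstBelow u) (1 - (1 - u) ^ 2) where
  abs_le h hh v := by
    unfold fstBelow
    split_ifs
    · rw [mul_one, abs_of_nonneg (by positivity)]
      gcongr
      simp
    · simp only [mul_zero, abs_zero]; positivity
  tendsto := by
    have h1 := tendsto_mean_snd_le zero_le_one le_rfl
    have h2 := tendsto_mean_snd_lt (u := 1 - u) (by linarith) (by linarith)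
    have h3 := h1.sub h2
    rw [one_pow] at h3
    refine h3.congr' ?_
    filter_upwards [self_mem_nhdsWithin] with h hh
    have hh : 0 < h := hh
    rw [← sub_div]
    congr 1
    rw [← (Equiv.prodComm ℕ ℕ).tsum_eq fun v => geomWeight h v * fstBelow u h v,
      ← Summable.tsum_sub]
    · refine tsum_congr fun v => ?_
      have e : geomWeight h (Equiv.prodComm ℕ ℕ v) = geomWeight h v := by
        unfold geomWeight; simp [add_comm]
      rw [e, ← mul_sub]
      congr 1
      have e2 : fstBelow u h (Equiv.prodComm ℕ ℕ v) =
          h * v.2 * (if (1 - u) * (v.1 : ℝ) ≤ u * v.2 then 1 else 0) := rfl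
      rw [e2]
      have : (v.1 : ℝ) ≥ 0 := by positivity
      simp only [sub_self, zero_mul, one_mul, this.le, if_true, sub_sub_cancel]
      by_cases hc : (1 - u) * (v.1 : ℝ) ≤ u * v.2
      · rw [if_pos hc, if_neg (not_lt.2 hc)]; ring
      · rw [if_neg hc, if_pos (not_le.1 hc)]; ring
    · exact summable_geomWeight_mul hh fun v => (hasGeomMean_sndBelow zero_le_one le_rfl).abs_le h hh v
    · refine summable_geomWeight_mul hh fun v => ?_
      split_ifs
      · rw [mul_one, abs_of_nonneg (by positivity)]
        gcongr
        simp
      · simp only [mul_zero, abs_zero]; positivity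

lemma coprime_pair_eq_of_cross {a b c d : ℕ} (h1 : Nat.gcd a b = 1) (h2 : Nat.gcd c d = 1)
    (h : a * d = b * c) : a = c ∧ b = d := by
  have h1' : Nat.Coprime a b := h1
  have h2' : Nat.Coprime c d := h2
  constructor
  · exact Nat.dvd_antisymm (h1'.dvd_of_dvd_mul_left (h ▸ dvd_mul_right a d))
      (h2'.dvd_of_dvd_mul_right (h ▸ dvd_mul_left c b))
  · exact Nat.dvd_antisymm (h1'.symm.dvd_of_dvd_mul_left (h ▸ dvd_mul_right b c))
      (h2'.symm.dvd_of_dvd_mul_right (h ▸ dvd_mul_left d a))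

lemma eq_of_cross_of_gcd_eq {x y : ℕ × ℕ} (hx : 0 < x.1)
    (h : x.1 * y.2 = x.2 * y.1) (hg : Nat.gcd x.1 x.2 = Nat.gcd y.1 y.2) : x = y := by
  obtain ⟨a, b, hab, ha, hb⟩ := Nat.exists_coprime x.1 x.2
  obtain ⟨c, d, hcd, hc, hd⟩ := Nat.exists_coprime y.1 y.2
  have hg1 : 0 < Nat.gcd x.1 x.2 := Nat.gcd_pos_of_pos_left _ hx
  rw [← hg] at hc hd
  set g := Nat.gcd x.1 x.2
  have : a = c ∧ b = d := by
    refine coprime_pair_eq_of_cross hab hcd ?_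
    rw [ha, hb, hc, hd] at h
    have h' : (g * g) * (a * d) = (g * g) * (b * c) := by linarith
    exact Nat.eq_of_mul_eq_mul_left (by positivity) h'
  ext
  · rw [ha, hc, this.1]
  · rw [hb, hd, this.2]

/-- The vectors of a tuple are pairwise non-parallel. -/
def PairwiseNonparallel {k : ℕ} (v : Fin k → ℕ × ℕ) : Prop :=
  ∀ i j, i ≠ j → (v i).1 * (v j).2 ≠ (v i).2 * (v j).1

lemma PairwiseNonparallel.snoc {k : ℕ} {v : Fin k → ℕ × ℕ} (hv : PairwiseNonparallel v)
    {x : ℕ × ℕ} (hx : ∀ i, x.1 * (v i).2 ≠ x.2 * (v i).1) :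
    PairwiseNonparallel (Fin.snoc v x : Fin (k + 1) → ℕ × ℕ) := by
  intro i j
  refine Fin.lastCases ?_ (fun i => ?_) i <;> refine Fin.lastCases ?_ (fun j => ?_) j
  · simp
  · intro _
    simpa using hx j
  · intro _ h
    simp only [Fin.snoc_castSucc, Fin.snoc_last] at h
    exact hx i (by linarith)
  · intro hij
    simpa using hv i j (fun h => hij (by rw [h]))

lemma card_parallel_le (G : ℕ) (A : Finset (ℕ × ℕ))
    (hA : ∀ x ∈ A, 0 < x.1 ∧ 0 < x.2 ∧ Nat.gcd x.1 x.2 ≤ G) {v : ℕ × ℕ} (hv : 0 < v.1)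
    : (A.filter fun x => x.1 * v.2 = x.2 * v.1).card ≤ G := by
  calc _ ≤ (Finset.Icc 1 G).card := by
        refine Finset.card_le_card_of_injOn (fun x => Nat.gcd x.1 x.2) ?_ ?_
        · intro x hx
          simp only [Finset.coe_filter, Set.mem_ofPred_eq] at hx
          have := hA x hx.1
          simp only [Finset.coe_Icc, Set.mem_Icc]
          exact ⟨Nat.gcd_pos_of_pos_left _ this.1, this.2.2⟩
        · intro x hx y hy hxy
          simp only [Finset.coe_filter, Set.mem_ofPred_eq] at hx hy
          have hx1 := (hA x hx.1).1
          refine eq_of_cross_of_gcd_eq hx1 ?_ hxy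
          have h' : v.1 * (x.1 * y.2) = v.1 * (x.2 * y.1) := by
            calc v.1 * (x.1 * y.2) = x.1 * (y.2 * v.1) := by ring
              _ = x.1 * (y.1 * v.2) := by rw [hy.2]
              _ = (x.1 * v.2) * y.1 := by ring
              _ = (x.2 * v.1) * y.1 := by rw [hx.2]
              _ = _ := by ring
          exact Nat.eq_of_mul_eq_mul_left hv h'
    _ = G := by simp

open Classical in
/-- The tuples of pairwise non-parallel vectors from `A`. -/
noncomputable def nonparallelTuples (A : Finset (ℕ × ℕ)) (k : ℕ) : Finset (Fin k → ℕ × ℕ) :=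
  (Fintype.piFinset fun _ => A).filter PairwiseNonparallel

lemma mem_nonparallelTuples {A : Finset (ℕ × ℕ)} {k : ℕ} {v : Fin k → ℕ × ℕ} :
    v ∈ nonparallelTuples A k ↔ (∀ i, v i ∈ A) ∧ PairwiseNonparallel v := by
  simp [nonparallelTuples]

lemma sum_nonparallelTuples_succ_ge {h : ℝ} (hh : 0 < h) {G : ℕ} {A : Finset (ℕ × ℕ)}
    (hA : ∀ x ∈ A, 0 < x.1 ∧ 0 < x.2 ∧ Nat.gcd x.1 x.2 ≤ G) (k : ℕ) :
    (∑ v ∈ nonparallelTuples A k, ∏ i, geomWeight h (v i)) *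
      (∑ x ∈ A, geomWeight h x - k * G) ≤
    ∑ v ∈ nonparallelTuples A (k + 1), ∏ i, geomWeight h (v i) := by
  classical
  set C : (Fin k → ℕ × ℕ) → Finset (ℕ × ℕ) :=
    fun v => A.filter fun x => ∀ i, x.1 * (v i).2 ≠ x.2 * (v i).1 with hC
  have hCw : ∀ v ∈ nonparallelTuples A k,
      ∑ x ∈ A, geomWeight h x - k * G ≤ ∑ x ∈ C v, geomWeight h x := by
    intro v hv
    rw [mem_nonparallelTuples] at hv
    set D : Finset (ℕ × ℕ) := Finset.univ.biUnion
        fun i => A.filter fun x => x.1 * (v i).2 = x.2 * (v i).1 with hD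
    have h1 : A ⊆ C v ∪ D := by
      intro x hx
      simp only [hC, hD, Finset.mem_union, Finset.mem_filter, Finset.mem_biUnion, Finset.mem_univ,
        true_and]
      by_cases hxv : ∀ i, x.1 * (v i).2 ≠ x.2 * (v i).1
      · exact Or.inl ⟨hx, hxv⟩
      · push Not at hxv
        obtain ⟨i, hi⟩ := hxv
        exact Or.inr ⟨i, hx, hi⟩
    have h2 : ∑ x ∈ A, geomWeight h x ≤ ∑ x ∈ C v, geomWeight h x +
        ∑ x ∈ D, geomWeight h x := by
      refine (Finset.sum_le_sum_of_subset_of_nonneg h1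
        fun x _ _ => (geomWeight_pos h x).le).trans ?_
      rw [← Finset.sum_union_inter]
      have : 0 ≤ ∑ x ∈ C v ∩ D, geomWeight h x :=
        Finset.sum_nonneg fun x _ => (geomWeight_pos h x).le
      linarith
    have h3 : ∑ x ∈ D, geomWeight h x ≤ k * G := by
      calc _ ≤ ∑ x ∈ D, (1 : ℝ) :=
            Finset.sum_le_sum fun x _ => geomWeight_le_one hh.le x
        _ = ((D).card : ℝ) := by simp
        _ ≤ ((k * G : ℕ) : ℝ) := by
            refine Nat.cast_le.2 ((Finset.card_biUnion_le_card_mul _ _ G fun i _ => ?_).trans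
              (by simp))
            exact card_parallel_le G A hA (hA _ (hv.1 i)).1
        _ = _ := by push_cast; rfl
    linarith
  calc _ = ∑ v ∈ nonparallelTuples A k, (∏ i, geomWeight h (v i)) *
      (∑ x ∈ A, geomWeight h x - k * G) := by rw [Finset.sum_mul]
    _ ≤ ∑ v ∈ nonparallelTuples A k, (∏ i, geomWeight h (v i)) * ∑ x ∈ C v, geomWeight h x := by
        refine Finset.sum_le_sum fun v hv => mul_le_mul_of_nonneg_left (hCw v hv) ?_
        exact Finset.prod_nonneg fun i _ => (geomWeight_pos _ _).le
    _ = ∑ p ∈ (nonparallelTuples A k).sigma C,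
          ∏ i, geomWeight h ((Fin.snoc p.1 p.2 : Fin (k + 1) → ℕ × ℕ) i) := by
        rw [Finset.sum_sigma]
        refine Finset.sum_congr rfl fun v _ => ?_
        rw [Finset.mul_sum]
        refine Finset.sum_congr rfl fun x _ => ?_
        rw [Fin.prod_univ_castSucc]
        simp
    _ ≤ _ := by
        rw [← Finset.sum_image (s := (nonparallelTuples A k).sigma C)
          (g := fun p => (Fin.snoc p.1 p.2 : Fin (k + 1) → ℕ × ℕ))
          (f := fun v => ∏ i, geomWeight h (v i))]
        · refine Finset.sum_le_sum_of_subset_of_nonneg ?_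
            fun v _ _ => Finset.prod_nonneg fun i _ => (geomWeight_pos _ _).le
          intro w hw
          rw [Finset.mem_image] at hw
          obtain ⟨⟨v, x⟩, hp, rfl⟩ := hw
          rw [Finset.mem_sigma, mem_nonparallelTuples] at hp
          simp only [hC, Finset.mem_filter] at hp
          rw [mem_nonparallelTuples]
          refine ⟨fun i => ?_, hp.1.2.snoc hp.2.2⟩
          refine Fin.lastCases ?_ (fun i => ?_) i
          · simpa using hp.2.1
          · simpa using hp.1.1 i
        · rintro ⟨v, x⟩ _ ⟨v', x'⟩ _ e
          simp only at e
          have h1 : v = v' := by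
            have := congrArg Fin.init e
            simpa [Fin.init_snoc] using this
          have h2 : x = x' := by
            have := congrFun e (Fin.last k)
            simpa using this
          subst h1 h2
          rfl

lemma sum_nonparallelTuples_ge {h : ℝ} (hh : 0 < h) {G : ℕ} {A : Finset (ℕ × ℕ)}
    (hA : ∀ x ∈ A, 0 < x.1 ∧ 0 < x.2 ∧ Nat.gcd x.1 x.2 ≤ G) {K : ℕ} {W : ℝ} (hW0 : 0 ≤ W)
    (hW : W ≤ ∑ x ∈ A, geomWeight h x - K * G) {k : ℕ} (hk : k ≤ K) :
    W ^ k ≤ ∑ v ∈ nonparallelTuples A k, ∏ i, geomWeight h (v i) := by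
  induction k with
  | zero =>
    have : nonparallelTuples A 0 = Finset.univ := by
      ext v
      simp only [mem_nonparallelTuples, PairwiseNonparallel, IsEmpty.forall_iff, and_self,
        Finset.mem_univ]
    rw [this]
    simp
  | succ k ih =>
    refine le_trans ?_ (sum_nonparallelTuples_succ_ge hh hA k)
    rw [pow_succ]
    have : (k : ℝ) * G ≤ K * G := by
      have : k ≤ K := by omega
      gcongr
    exact mul_le_mul (ih (by omega)) (by linarith) hW0
      (Finset.sum_nonneg fun v _ => Finset.prod_nonneg fun i _ => (geomWeight_pos _ _).le)

/-- The geometric weight restricted to vectors with positive coordinates. -/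
noncomputable def posWeight (h : ℝ) (v : ℕ × ℕ) : ℝ :=
  if 0 < v.1 ∧ 0 < v.2 then geomWeight h v else 0

lemma posWeight_nonneg (h : ℝ) (v : ℕ × ℕ) : 0 ≤ posWeight h v := by
  unfold posWeight
  split_ifs
  · exact (geomWeight_pos h v).le
  · rfl

lemma hasSum_posWeight {h : ℝ} (hh : 0 < h) :
    HasSum (posWeight h) (exp (-(2 * h)) * totalWeight h) := by
  have hinj : Function.Injective fun v : ℕ × ℕ => (v.1 + 1, v.2 + 1) := by
    rintro ⟨a, b⟩ ⟨a', b'⟩ e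
    simpa using e
  rw [← hinj.hasSum_iff]
  · refine ((summable_geomWeight hh).hasSum.mul_left (exp (-(2 * h)))).congr_fun fun v => ?_
    simp only [Function.comp, posWeight, Nat.succ_pos', and_self, if_true, geomWeight]
    rw [← exp_add]
    push_cast
    ring_nf
  · rintro ⟨a, b⟩ hv
    unfold posWeight
    rw [if_neg]
    rintro ⟨h1, h2⟩
    simp only at h1 h2
    exact hv ⟨(a - 1, b - 1), by simp [Nat.sub_add_cancel h1, Nat.sub_add_cancel h2]⟩

lemma tsum_posWeight_le {h : ℝ} (hh : 0 < h) : ∑' v, posWeight h v ≤ (h ^ 2)⁻¹ := by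
  rw [(hasSum_posWeight hh).tsum_eq, totalWeight_eq hh]
  have h1 := exp_neg_lt_one hh
  have h2 := add_one_le_exp h
  have h3 : exp (-(2 * h)) = exp (-h) * exp (-h) := by rw [← exp_add]; ring_nf
  have h4 : exp (-h) * exp h = 1 := by rw [← exp_add]; simp
  have h5 := exp_pos (-h)
  have h6 : exp (-h) * (1 - exp (-h))⁻¹ ≤ h⁻¹ := by
    rw [← div_eq_mul_inv, div_le_iff₀ (by linarith), inv_mul_eq_div, le_div_iff₀ hh]
    nlinarith
  have h7 : 0 ≤ exp (-h) * (1 - exp (-h))⁻¹ :=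
    mul_nonneg h5.le (inv_nonneg.2 (by linarith))
  calc _ = (exp (-h) * (1 - exp (-h))⁻¹) * (exp (-h) * (1 - exp (-h))⁻¹) := by rw [h3]; ring
    _ ≤ h⁻¹ * h⁻¹ := mul_le_mul h6 h6 h7 (by positivity)
    _ = _ := by rw [← mul_inv, sq]

lemma sum_gcd_eq_le {h : ℝ} (hh : 0 < h) {g : ℕ} (hg : 0 < g) (B : Finset (ℕ × ℕ))
    (hB : ∀ v ∈ B, 0 < v.1 ∧ 0 < v.2 ∧ Nat.gcd v.1 v.2 = g) :
    ∑ v ∈ B, geomWeight h v ≤ (h ^ 2)⁻¹ * ((g : ℝ) ^ 2)⁻¹ := by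
  have hg' : (0 : ℝ) < g := by exact_mod_cast hg
  have hdiv : ∀ v ∈ B, g * (v.1 / g) = v.1 ∧ g * (v.2 / g) = v.2 := by
    intro v hv
    have := (hB v hv).2.2
    exact ⟨Nat.mul_div_cancel' (this ▸ Nat.gcd_dvd_left _ _),
      Nat.mul_div_cancel' (this ▸ Nat.gcd_dvd_right _ _)⟩
  calc ∑ v ∈ B, geomWeight h v = ∑ v ∈ B, posWeight (h * g) (v.1 / g, v.2 / g) := by
        refine Finset.sum_congr rfl fun v hv => ?_
        obtain ⟨h1, h2⟩ := hdiv v hv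
        obtain ⟨h3, h4, -⟩ := hB v hv
        have h5 : 0 < v.1 / g := Nat.pos_of_mul_pos_left (a := g) (by omega)
        have h6 : 0 < v.2 / g := Nat.pos_of_mul_pos_left (a := g) (by omega)
        unfold posWeight
        rw [if_pos ⟨h5, h6⟩]
        unfold geomWeight
        have h1' : (g : ℝ) * ((v.1 / g : ℕ) : ℝ) = v.1 := by exact_mod_cast h1
        have h2' : (g : ℝ) * ((v.2 / g : ℕ) : ℝ) = v.2 := by exact_mod_cast h2
        congr 1
        rw [← h1', ← h2']
        ring
    _ = ∑ w ∈ B.image (fun v => (v.1 / g, v.2 / g)), posWeight (h * g) w := by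
        rw [Finset.sum_image]
        intro v hv w hw e
        simp only [Prod.mk.injEq] at e
        ext
        · rw [← (hdiv v hv).1, ← (hdiv w hw).1, e.1]
        · rw [← (hdiv v hv).2, ← (hdiv w hw).2, e.2]
    _ ≤ ∑' w, posWeight (h * g) w :=
        (hasSum_posWeight (by positivity)).summable.sum_le_tsum _ fun v _ => posWeight_nonneg _ v
    _ ≤ ((h * g) ^ 2)⁻¹ := tsum_posWeight_le (by positivity)
    _ = _ := by rw [mul_pow, mul_inv]

lemma sum_large_gcd_le {h : ℝ} (hh : 0 < h) {G : ℕ} (hG : 0 < G) (B : Finset (ℕ × ℕ))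
    (hB : ∀ v ∈ B, 0 < v.1 ∧ 0 < v.2 ∧ G < Nat.gcd v.1 v.2) :
    ∑ v ∈ B, geomWeight h v ≤ totalWeight h * (G : ℝ)⁻¹ := by
  set M := (B.image fun v => Nat.gcd v.1 v.2).sup id + G with hM
  have hmaps : ∀ v ∈ B, Nat.gcd v.1 v.2 ∈ Finset.Ioc G M := by
    intro v hv
    rw [Finset.mem_Ioc]
    refine ⟨(hB v hv).2.2, ?_⟩
    have := Finset.le_sup (f := id) (Finset.mem_image_of_mem (fun v : ℕ × ℕ => Nat.gcd v.1 v.2) hv)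
    simp only [id] at this
    simp only [hM]
    exact this.trans (Nat.le_add_right _ _)
  rw [← Finset.sum_fiberwise_of_maps_to hmaps]
  calc _ ≤ ∑ g ∈ Finset.Ioc G M, (h ^ 2)⁻¹ * ((g : ℝ) ^ 2)⁻¹ := by
        refine Finset.sum_le_sum fun g hg => ?_
        rw [Finset.mem_Ioc] at hg
        refine sum_gcd_eq_le hh (by omega) _ fun v hv => ?_
        rw [Finset.mem_filter] at hv
        exact ⟨(hB v hv.1).1, (hB v hv.1).2.1, hv.2⟩
    _ = (h ^ 2)⁻¹ * ∑ g ∈ Finset.Ioc G M, ((g : ℝ) ^ 2)⁻¹ := by rw [Finset.mul_sum]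
    _ ≤ (h ^ 2)⁻¹ * (G : ℝ)⁻¹ := by
        gcongr
        have := sum_Ioc_inv_sq_le_sub (α := ℝ) hG.ne' (show G ≤ M by omega)
        have : (0 : ℝ) ≤ (M : ℝ)⁻¹ := by positivity
        linarith
    _ ≤ _ := by
        gcongr
        rw [← one_div]
        exact totalWeight_ge hh

/-- Vectors of bounded gcd carry almost all of the geometric weight. -/
lemma exists_finset_bounded_gcd {ε : ℝ} (hε : 0 < ε) : ∃ G : ℕ, ∃ h₀ > 0, ∀ h, 0 < h → h < h₀ →
    ∃ A : Finset (ℕ × ℕ), (∀ x ∈ A, 0 < x.1 ∧ 0 < x.2 ∧ Nat.gcd x.1 x.2 ≤ G) ∧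
      (1 - ε) * totalWeight h ≤ ∑ x ∈ A, geomWeight h x := by
  classical
  obtain ⟨G, hG⟩ := exists_nat_gt (3 / ε)
  have hG0 : (0 : ℝ) < G := lt_trans (by positivity) hG
  have hGε : (G : ℝ)⁻¹ ≤ ε / 3 := by
    rw [inv_le_comm₀ hG0 (by positivity), inv_div]
    exact hG.le
  refine ⟨G, ε / 6, by positivity, fun h hh hlt => ?_⟩
  have hS := totalWeight_pos hh
  have hev := (hasSum_posWeight hh).eventually
    (lt_mem_nhds (show exp (-(2 * h)) * totalWeight h - ε / 3 * totalWeight h <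
      exp (-(2 * h)) * totalWeight h by nlinarith [mul_pos hε hS]))
  obtain ⟨B, hB⟩ := hev.exists
  refine ⟨B.filter fun v => (0 < v.1 ∧ 0 < v.2) ∧ Nat.gcd v.1 v.2 ≤ G, fun x hx => ?_, ?_⟩
  · rw [Finset.mem_filter] at hx
    exact ⟨hx.2.1.1, hx.2.1.2, hx.2.2⟩
  have h1 : ∑ v ∈ B, posWeight h v = ∑ v ∈ B.filter fun v => 0 < v.1 ∧ 0 < v.2, geomWeight h v := by
    rw [Finset.sum_filter]
    rfl
  have h2 := Finset.sum_filter_add_sum_filter_not (B.filter fun v => 0 < v.1 ∧ 0 < v.2)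
    (fun v => Nat.gcd v.1 v.2 ≤ G) (geomWeight h)
  rw [Finset.filter_filter] at h2
  have h3 := sum_large_gcd_le hh (by exact_mod_cast hG0) ((B.filter fun v => 0 < v.1 ∧ 0 < v.2).filter
    (fun v => ¬ Nat.gcd v.1 v.2 ≤ G)) (fun v hv => by
      simp only [Finset.mem_filter, not_le] at hv
      exact ⟨hv.1.2.1, hv.1.2.2, hv.2⟩)
  have h4 : totalWeight h * (G : ℝ)⁻¹ ≤ totalWeight h * (ε / 3) := by gcongr
  have h5 : 1 - ε / 3 ≤ exp (-(2 * h)) := by linarith [add_one_le_exp (-(2 * h))]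
  have h6 : (1 - ε / 3) * totalWeight h ≤ exp (-(2 * h)) * totalWeight h := by gcongr
  rw [h1] at hB
  linarith

/-- Exponential two-sided tail bound for sums of i.i.d. functionals of geometric vectors. -/
lemma HasGeomMean.abs_tail {f : ℝ → ℕ × ℕ → ℝ} {μ : ℝ} (hf : HasGeomMean f μ) {ε : ℝ}
    (hε : 0 < ε) : ∃ c > 0, ∃ h₀ > 0, ∀ h, 0 < h → h < h₀ → ∀ (k : ℕ)
      (T : Finset (Fin k → ℕ × ℕ)), (∀ v ∈ T, k * ε ≤ |∑ i, f h (v i) - k * μ|) →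
      ∑ v ∈ T, ∏ i, geomWeight h (v i) ≤ 2 * exp (-c * k) * totalWeight h ^ k := by
  classical
  obtain ⟨c₁, hc₁, h₁, hh₁, H₁⟩ := hf.upper_tail hε
  obtain ⟨c₂, hc₂, h₂, hh₂, H₂⟩ := hf.neg.upper_tail hε
  refine ⟨min c₁ c₂, by positivity, min h₁ h₂, by positivity, fun h hh hlt k T hT => ?_⟩
  have hS := totalWeight_pos hh
  rw [lt_min_iff] at hlt
  rw [← Finset.sum_filter_add_sum_filter_not T (fun v => k * (μ + ε) ≤ ∑ i, f h (v i))]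
  have e1 := H₁ h hh hlt.1 k (T.filter fun v => k * (μ + ε) ≤ ∑ i, f h (v i))
    fun v hv => (Finset.mem_filter.1 hv).2
  have e2 := H₂ h hh hlt.2 k (T.filter fun v => ¬ k * (μ + ε) ≤ ∑ i, f h (v i)) fun v hv => by
    rw [Finset.mem_filter] at hv
    have h1 := hT v hv.1
    rw [Finset.sum_neg_distrib]
    rcases le_abs.1 h1 with h2 | h2
    · exact absurd (by linarith) hv.2
    · linarith
  have e3 : exp (-c₁ * k) ≤ exp (-min c₁ c₂ * k) := by gcongr; exact min_le_left _ _
  have e4 : exp (-c₂ * k) ≤ exp (-min c₁ c₂ * k) := by gcongr; exact min_le_right _ _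
  have e5 : 0 < totalWeight h ^ k := by positivity
  have e6 := mul_le_mul_of_nonneg_right e3 e5.le
  have e7 := mul_le_mul_of_nonneg_right e4 e5.le
  linarith

lemma HasGeomMean.abs_tail_finset {ι : Type*} {f : ι → ℝ → ℕ × ℕ → ℝ} {μ : ι → ℝ}
    (s : Finset ι) (hf : ∀ j ∈ s, HasGeomMean (f j) (μ j)) {ε : ℝ}
    (hε : 0 < ε) : ∃ c > 0, ∃ h₀ > 0, ∀ h, 0 < h → h < h₀ → ∀ (k : ℕ)
      (T : Finset (Fin k → ℕ × ℕ)), (∀ v ∈ T, ∃ j ∈ s, k * ε ≤ |∑ i, f j h (v i) - k * μ j|) →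
      ∑ v ∈ T, ∏ i, geomWeight h (v i) ≤ s.card * (2 * exp (-c * k) * totalWeight h ^ k) := by
  classical
  induction s using Finset.induction_on with
  | empty =>
    refine ⟨1, one_pos, 1, one_pos, fun h _ _ k T hT => ?_⟩
    have : T = ∅ := Finset.eq_empty_of_forall_notMem fun v hv => by simpa using hT v hv
    simp [this]
  | insert a s ha ih =>
    obtain ⟨c₁, hc₁, h₁, hh₁, H₁⟩ := (hf a (Finset.mem_insert_self a s)).abs_tail hε
    obtain ⟨c₂, hc₂, h₂, hh₂, H₂⟩ := ih fun j hj => hf j (Finset.mem_insert_of_mem hj)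
    refine ⟨min c₁ c₂, by positivity, min h₁ h₂, by positivity, fun h hh hlt k T hT => ?_⟩
    have hS := totalWeight_pos hh
    rw [lt_min_iff] at hlt
    rw [← Finset.sum_filter_add_sum_filter_not T (fun v => k * ε ≤ |∑ i, f a h (v i) - k * μ a|)]
    have e1 := H₁ h hh hlt.1 k (T.filter fun v => k * ε ≤ |∑ i, f a h (v i) - k * μ a|)
      fun v hv => (Finset.mem_filter.1 hv).2
    have e2 := H₂ h hh hlt.2 k (T.filter fun v => ¬ k * ε ≤ |∑ i, f a h (v i) - k * μ a|)
      fun v hv => by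
        rw [Finset.mem_filter] at hv
        obtain ⟨j, hj, hj2⟩ := hT v hv.1
        rcases Finset.mem_insert.1 hj with rfl | hj
        · exact absurd hj2 hv.2
        · exact ⟨j, hj, hj2⟩
    have e3 : exp (-c₁ * k) ≤ exp (-min c₁ c₂ * k) := by gcongr; exact min_le_left _ _
    have e4 : exp (-c₂ * k) ≤ exp (-min c₁ c₂ * k) := by gcongr; exact min_le_right _ _
    have e5 : 0 < totalWeight h ^ k := by positivity
    have e6 := mul_le_mul_of_nonneg_right e3 e5.le
    have e7 := mul_le_mul_of_nonneg_right e4 e5.le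
    have e8 := mul_le_mul_of_nonneg_left e7 (show (0 : ℝ) ≤ s.card by positivity)
    rw [Finset.card_insert_of_notMem ha]
    push_cast
    linarith

lemma prod_geomWeight (h : ℝ) {k : ℕ} (v : Fin k → ℕ × ℕ) :
    ∏ i, geomWeight h (v i) = exp (-(∑ i, h * ((v i).1 : ℝ) + ∑ i, h * ((v i).2 : ℝ))) := by
  unfold geomWeight
  rw [← exp_sum, ← Finset.sum_add_distrib, ← Finset.sum_neg_distrib]
  congr 1
  refine Finset.sum_congr rfl fun i _ => ?_
  ring

lemma fstBelow_one (h : ℝ) (v : ℕ × ℕ) : fstBelow 1 h v = h * v.1 := by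
  have : (1 - 1 : ℝ) * v.2 ≤ 1 * v.1 := by rw [sub_self, zero_mul, one_mul]; positivity
  rw [fstBelow, if_pos this, mul_one]

lemma sndBelow_one (h : ℝ) (v : ℕ × ℕ) : sndBelow 1 h v = h * v.2 := by
  have : (1 - 1 : ℝ) * v.2 ≤ 1 * v.1 := by rw [sub_self, zero_mul, one_mul]; positivity
  rw [sndBelow, if_pos this, mul_one]

/-- There are many tuples of pairwise non-parallel vectors with total close to `(k / h, k / h)`. -/
lemma exists_many_nonparallel {η : ℝ} (hη : 0 < η) :
    ∃ h₀ > 0, ∃ σ > 0, ∃ k₀ : ℕ, ∀ h : ℝ, 0 < h → h < h₀ → ∀ k : ℕ, k₀ ≤ k → k ≤ σ / h ^ 2 →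
      ∃ T : Finset (Fin k → ℕ × ℕ), (∀ v ∈ T, (∀ i, 0 < (v i).1 ∧ 0 < (v i).2) ∧
        PairwiseNonparallel v ∧ ∑ i, h * ((v i).1 : ℝ) ≤ k * (1 + η) ∧
        ∑ i, h * ((v i).2 : ℝ) ≤ k * (1 + η)) ∧
      exp (2 * k * (1 - η)) * (1 / 2 * exp (-η * k) * totalWeight h ^ k) ≤ T.card := by
  classical
  obtain ⟨c, hc, h₁, hh₁, H₁⟩ := HasGeomMean.abs_tail_finset
    (f := fun b : Bool => cond b (fstBelow 1) (sndBelow 1)) (μ := fun _ => 1)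
    Finset.univ (fun b _ => by
      cases b
      · have := hasGeomMean_sndBelow zero_le_one le_rfl
        rwa [one_pow] at this
      · have := hasGeomMean_fstBelow zero_le_one le_rfl
        rwa [sub_self, zero_pow two_ne_zero, sub_zero] at this) hη
  set η₁ := min η (c / 2) with hη₁
  have hη₁0 : 0 < η₁ := by positivity
  have hη₁η : η₁ ≤ η := min_le_left _ _
  have hη₁c : η₁ ≤ c / 2 := min_le_right _ _
  set ε := (1 - exp (-η₁)) / 2 with hε
  have hε0 : 0 < ε := by
    have := exp_neg_lt_one hη₁0
    rw [hε]; linarith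
  obtain ⟨G, h₂, hh₂, H₂⟩ := exists_finset_bounded_gcd hε0
  obtain ⟨k₀, hk₀⟩ := exists_nat_gt (16 / c)
  refine ⟨min h₁ h₂, by positivity, ε / (G + 1), by positivity, k₀, fun h hh hlt k hk hkσ => ?_⟩
  rw [lt_min_iff] at hlt
  have hS := totalWeight_pos hh
  obtain ⟨A, hA, hAW⟩ := H₂ h hh hlt.2
  have hkG : (k : ℝ) * G ≤ ε * totalWeight h := by
    calc (k : ℝ) * G ≤ k * (G + 1) := by gcongr; linarith
      _ ≤ (ε / (G + 1) / h ^ 2) * (G + 1) := by gcongr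
      _ = ε * (1 / h ^ 2) := by field_simp
      _ ≤ _ := by gcongr; exact totalWeight_ge hh
  have hlow := sum_nonparallelTuples_ge hh hA (K := k) (W := exp (-η₁) * totalWeight h)
    (by positivity) (by
      have : exp (-η₁) = 1 - 2 * ε := by rw [hε]; ring
      rw [this]; linarith) le_rfl
  set good : (Fin k → ℕ × ℕ) → Prop := fun v =>
    |∑ i, h * ((v i).1 : ℝ) - k| < k * η ∧ |∑ i, h * ((v i).2 : ℝ) - k| < k * η with hgood
  rw [← Finset.sum_filter_add_sum_filter_not _ good, mul_pow, ← exp_nat_mul] at hlow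
  have hbad := H₁ h hh hlt.1 k ((nonparallelTuples A k).filter fun v => ¬ good v) fun v hv => by
    have hv := (Finset.mem_filter.1 hv).2
    simp only [hgood, not_and_or, not_lt] at hv
    rcases hv with hv | hv
    · exact ⟨true, Finset.mem_univ _, by simpa only [cond_true, fstBelow_one, mul_one] using hv⟩
    · exact ⟨false, Finset.mem_univ _, by simpa only [cond_false, sndBelow_one, mul_one] using hv⟩
  have hkc : 16 ≤ c * k := by
    have : (k₀ : ℝ) ≤ k := by exact_mod_cast hk
    have := hk₀.le.trans this
    rwa [div_le_iff₀' hc] at this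
  have e1 : 4 * exp (-c * k) ≤ 1 / 2 * exp (-η₁ * k) := by
    have e2 : exp (-c * k) ≤ exp (-η₁ * k) * exp (-8) := by
      rw [← exp_add]
      gcongr
      have : η₁ * k ≤ c / 2 * k := by gcongr
      linarith
    have e3 : exp (-8) ≤ 1 / 8 := by
      rw [exp_neg, ← one_div]
      gcongr
      linarith [add_one_le_exp (8 : ℝ)]
    have := exp_pos (-η₁ * k)
    nlinarith
  have e4 : exp (-η * k) ≤ exp (-η₁ * k) := by gcongr
  have hSk : 0 < totalWeight h ^ k := by positivity
  have hge : 1 / 2 * exp (-η * k) * totalWeight h ^ k ≤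
      ∑ v ∈ (nonparallelTuples A k).filter good, ∏ i, geomWeight h (v i) := by
    have e5 := mul_le_mul_of_nonneg_right e1 hSk.le
    have e6 := mul_le_mul_of_nonneg_right e4 hSk.le
    have e7 : (k : ℝ) * -η₁ = -η₁ * k := by ring
    rw [e7] at hlow
    simp only [Finset.card_univ, Fintype.card_bool] at hbad
    push_cast at hbad
    linarith
  refine ⟨(nonparallelTuples A k).filter good, fun v hv => ?_, ?_⟩
  · rw [Finset.mem_filter, mem_nonparallelTuples] at hv
    obtain ⟨⟨h1, h2⟩, h3, h4⟩ := hv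
    rw [abs_lt] at h3 h4
    exact ⟨fun i => ⟨(hA _ (h1 i)).1, (hA _ (h1 i)).2.1⟩, h2, by linarith, by linarith⟩
  · have hw : ∑ v ∈ (nonparallelTuples A k).filter good, ∏ i, geomWeight h (v i) ≤
        ∑ v ∈ (nonparallelTuples A k).filter good, exp (-(2 * k * (1 - η))) := by
      refine Finset.sum_le_sum fun v hv => ?_
      rw [Finset.mem_filter] at hv
      obtain ⟨-, h3, h4⟩ := hv
      rw [abs_lt] at h3 h4
      rw [prod_geomWeight]
      gcongr
      linarith
    rw [Finset.sum_const, nsmul_eq_mul] at hw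
    calc _ ≤ exp (2 * k * (1 - η)) * (((nonparallelTuples A k).filter good).card *
          exp (-(2 * k * (1 - η)))) := mul_le_mul_of_nonneg_left (hge.trans hw) (exp_pos _).le
      _ = _ := by
        rw [mul_left_comm, ← exp_add]
        simp

lemma exists_mem_forall_not {ι α : Type*} [Fintype ι] (s : Finset α) (P : ι → α → Prop)
    (hP : ∀ i, ∀ x ∈ s, ∀ y ∈ s, P i x → P i y → x = y) (hs : Fintype.card ι < s.card) :
    ∃ x ∈ s, ∀ i, ¬ P i x := by
  by_contra! hcon
  obtain ⟨x₀, hx₀⟩ : s.Nonempty := Finset.card_pos.1 (by omega)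
  have : Nonempty ι := ⟨(hcon x₀ hx₀).choose⟩
  choose! c hc using hcon
  obtain ⟨x, hx, y, hy, hxy, he⟩ := Finset.exists_ne_map_eq_of_card_lt_of_maps_to
    (t := Finset.univ) (f := c) (by simpa using hs) (fun x _ => Finset.mem_univ _)
  exact hxy (hP _ x hx y hy (hc x hx) (he ▸ hc y hy))

/-- A short tuple of non-parallel vectors extends by two vectors to one with prescribed sum. -/
lemma exists_extension {n k : ℕ} {v : Fin k → ℕ × ℕ} (hv : ∀ i, 0 < (v i).1 ∧ 0 < (v i).2)
    (hnp : PairwiseNonparallel v) (h1 : ∑ i, (v i).1 + (2 * k + 3) ≤ n)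
    (h2 : ∑ i, (v i).2 + (2 * k + 3) ≤ n) :
    ∃ x y : ℕ × ℕ, (∀ i, 0 < ((Fin.snoc (Fin.snoc v x : Fin (k + 1) → ℕ × ℕ) y :
        Fin (k + 2) → ℕ × ℕ) i).1 ∧ 0 < ((Fin.snoc (Fin.snoc v x : Fin (k + 1) → ℕ × ℕ) y :
        Fin (k + 2) → ℕ × ℕ) i).2) ∧
      PairwiseNonparallel (Fin.snoc (Fin.snoc v x : Fin (k + 1) → ℕ × ℕ) y :
        Fin (k + 2) → ℕ × ℕ) ∧
      ∑ i, v i + x + y = (n, n) := by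
  obtain ⟨d₁, hd₁⟩ := Nat.exists_eq_add_of_le h1
  obtain ⟨d₂, hd₂⟩ := Nat.exists_eq_add_of_le h2
  set D₁ := d₁ + 2 * k + 2 with hD₁
  set D₂ := d₂ + 2 * k + 3 with hD₂
  obtain ⟨z, hz, hzP⟩ := exists_mem_forall_not (ι := (Fin k ⊕ Fin k) ⊕ Unit)
    (Finset.Icc 1 (D₂ - 1)) (fun i z => match i with
      | .inl (.inl i) => 1 * (v i).2 = z * (v i).1
      | .inl (.inr i) => D₁ * (v i).2 = (D₂ - z) * (v i).1
      | .inr _ => D₁ * z = (D₂ - z) * 1) (by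
    rintro ((i | i) | i) x hx y hy hx1 hy1 <;> rw [Finset.mem_Icc] at hx hy <;> simp only at hx1 hy1
    · exact Nat.eq_of_mul_eq_mul_right (hv i).1 (hx1.symm.trans hy1)
    · have := Nat.eq_of_mul_eq_mul_right (hv i).1 (hx1.symm.trans hy1)
      omega
    · rcases lt_trichotomy x y with h | h | h
      · have : D₁ * x ≤ D₁ * y := Nat.mul_le_mul_left _ h.le
        omega
      · exact h
      · have : D₁ * y ≤ D₁ * x := Nat.mul_le_mul_left _ h.le
        omega) (by
    simp only [Fintype.card_sum, Fintype.card_fin, Fintype.card_unit, Nat.card_Icc]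
    omega)
  rw [Finset.mem_Icc] at hz
  refine ⟨(1, z), (D₁, D₂ - z), fun i => ?_, ?_, ?_⟩
  · refine Fin.lastCases ?_ (fun i => ?_) i
    · simp only [Fin.snoc_last]; omega
    · rw [Fin.snoc_castSucc]
      refine Fin.lastCases ?_ (fun i => ?_) i
      · simp only [Fin.snoc_last]; omega
      · rw [Fin.snoc_castSucc]; exact hv i
  · refine (hnp.snoc fun i => ?_).snoc fun i => ?_
    · exact hzP (.inl (.inl i))
    · refine Fin.lastCases ?_ (fun i => ?_) i
      · rw [Fin.snoc_last]; exact hzP (.inr ())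
      · rw [Fin.snoc_castSucc]; exact hzP (.inl (.inr i))
  · ext
    · simp only [Prod.fst_add, Prod.fst_sum]; omega
    · simp only [Prod.snd_add, Prod.snd_sum]; omega

/-- Tuples of `N` pairwise non-parallel positive vectors with sum `(n, n)`. -/
noncomputable def chainTuples (n N : ℕ) : Finset (Fin N → ℕ × ℕ) :=
  (nonparallelTuples (Finset.Icc (1, 1) (n, n)) N).filter fun v => ∑ i, v i = (n, n)

lemma mem_chainTuples {n N : ℕ} {v : Fin N → ℕ × ℕ} : v ∈ chainTuples n N ↔
    (∀ i, 0 < (v i).1 ∧ 0 < (v i).2) ∧ PairwiseNonparallel v ∧ ∑ i, v i = (n, n) := by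
  unfold chainTuples
  rw [Finset.mem_filter, mem_nonparallelTuples, and_assoc, and_congr_left_iff]
  rintro ⟨-, hs⟩
  refine forall_congr' fun i => ?_
  have hle : v i ≤ (n, n) := by
    rw [← hs]
    exact Finset.single_le_sum (fun j _ => zero_le) (Finset.mem_univ i)
  rw [Finset.mem_Icc, and_iff_left hle, Prod.le_def]
  rfl

lemma card_le_card_chainTuples {n k : ℕ} (T : Finset (Fin k → ℕ × ℕ))
    (hT : ∀ v ∈ T, (∀ i, 0 < (v i).1 ∧ 0 < (v i).2) ∧ PairwiseNonparallel v ∧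
      ∑ i, (v i).1 + (2 * k + 3) ≤ n ∧ ∑ i, (v i).2 + (2 * k + 3) ≤ n) :
    T.card ≤ (chainTuples n (k + 2)).card := by
  have := fun v hv => exists_extension (hT v hv).1 (hT v hv).2.1 (hT v hv).2.2.1 (hT v hv).2.2.2
  choose! x y hxy using this
  refine Finset.card_le_card_of_injOn (fun v => (Fin.snoc (Fin.snoc v (x v) :
    Fin (k + 1) → ℕ × ℕ) (y v) : Fin (k + 2) → ℕ × ℕ)) (fun v hv => ?_) fun v _ w _ e => ?_
  · rw [Finset.mem_coe, mem_chainTuples]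
    obtain ⟨h1, h2, h3⟩ := hxy v hv
    refine ⟨h1, h2, ?_⟩
    rw [Fin.sum_univ_castSucc, Fin.sum_univ_castSucc]
    simpa using h3
  · have e1 := congrArg Fin.init (congrArg Fin.init e)
    simpa only [Fin.init_snoc] using e1

/-- The edge vectors of the chain of `ν`, listed along an enumeration of its support. -/
def edgeTuple {N : ℕ} (ν : Xc →₀ ℕ) (e : Fin N ≃ ν.support) (i : Fin N) : ℕ × ℕ :=
  ν (e i) • (e i).val.val

lemma sum_edgeTuple {N : ℕ} {M : Type*} [AddCommMonoid M] (ν : Xc →₀ ℕ) (e : Fin N ≃ ν.support)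
    (g : ℕ × ℕ → M) : ∑ i, g (edgeTuple ν e i) = ∑ x ∈ ν.support, g (ν x • x.val) := by
  rw [← Finset.sum_coe_sort ν.support]
  exact e.sum_comp fun x : ν.support => g (ν x • x.val.val)

lemma chainEndpoint_eq_sum (ν : Xc →₀ ℕ) : chainEndpoint ν = ∑ x ∈ ν.support, ν x • x.val := by
  unfold chainEndpoint Finsupp.sum
  ext
  · simp [Prod.fst_sum]
  · simp [Prod.snd_sum]

lemma gcd_smul (m : ℕ) (x : Xc) : Nat.gcd (m • x.val).1 (m • x.val).2 = m := by
  rw [Prod.smul_fst, Prod.smul_snd, smul_eq_mul, smul_eq_mul, Nat.gcd_mul_left, x.2, mul_one]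

lemma eq_of_smul_eq_smul {m m' : ℕ} {x x' : Xc} (hm : m ≠ 0) (h : m • x.val = m' • x'.val) :
    m = m' ∧ x = x' := by
  have e : m = m' := by rw [← gcd_smul m x, h, gcd_smul]
  subst e
  exact ⟨rfl, Subtype.ext (smul_right_injective _ hm h)⟩

lemma edgeTuple_injective {N : ℕ} {ν ν' : Xc →₀ ℕ} {e : Fin N ≃ ν.support}
    {e' : Fin N ≃ ν'.support} (h : edgeTuple ν e = edgeTuple ν' e') :
    ν = ν' ∧ ∀ i, (e i : Xc) = e' i := by
  have key : ∀ i, ν (e i) = ν' (e' i) ∧ (e i : Xc) = e' i := fun i =>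
    eq_of_smul_eq_smul (Finsupp.mem_support_iff.1 (e i).2) (congrFun h i)
  refine ⟨Finsupp.ext fun x => ?_, fun i => (key i).2⟩
  by_cases hx : x ∈ ν.support
  · obtain ⟨i, hi⟩ := e.surjective ⟨x, hx⟩
    have hk := key i
    rw [← hk.2, hi] at hk
    exact hk.1
  · by_cases hx' : x ∈ ν'.support
    · obtain ⟨i, hi⟩ := e'.surjective ⟨x, hx'⟩
      have hk : (e i : Xc) = x := (key i).2.trans (congrArg Subtype.val hi)
      have hmem := (e i).2
      rw [hk] at hmem
      exact absurd hmem hx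
    · rw [Finsupp.notMem_support_iff.1 hx, Finsupp.notMem_support_iff.1 hx']

/-- Chains with `N` edges satisfying `P`, together with an ordering of the edges, as tuples. -/
noncomputable def orderedEdges {n N : ℕ} {P : (Xc →₀ ℕ) → Prop}
    (p : {ν : Xc →₀ ℕ // chainEndpoint ν = (n, n) ∧ ν.support.card = N ∧ P ν} ×
      Equiv.Perm (Fin N)) : Fin N → ℕ × ℕ :=
  edgeTuple p.1.1 (p.2.trans (p.1.1.support.equivFinOfCardEq p.1.2.2.1).symm)

lemma orderedEdges_injective {n N : ℕ} {P : (Xc →₀ ℕ) → Prop} :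
    Function.Injective (orderedEdges (n := n) (N := N) (P := P)) := by
  rintro ⟨⟨ν, hν⟩, σ⟩ ⟨⟨ν', hν'⟩, σ'⟩ h
  obtain ⟨h1, h2⟩ := edgeTuple_injective h
  simp only at h1
  subst h1
  refine Prod.ext rfl (Equiv.ext fun i => ?_)
  simpa using Subtype.ext (h2 i)

open scoped Nat in
lemma finite_chains_and_card_mul_factorial_le {n N : ℕ} {P : (Xc →₀ ℕ) → Prop}
    (T : Finset (Fin N → ℕ × ℕ)) (hT : ∀ ν, chainEndpoint ν = (n, n) → P ν →
      ∀ e : Fin N ≃ ν.support, edgeTuple ν e ∈ T) :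
    Finite {ν : Xc →₀ ℕ // chainEndpoint ν = (n, n) ∧ ν.support.card = N ∧ P ν} ∧
    Nat.card {ν : Xc →₀ ℕ // chainEndpoint ν = (n, n) ∧ ν.support.card = N ∧ P ν} * N ! ≤
      T.card := by
  have hF : Function.Injective fun p => (⟨orderedEdges p, hT _ p.1.2.1 p.1.2.2.2 _⟩ : T) :=
    fun p q h => orderedEdges_injective (n := n) (N := N) (P := P) (congrArg Subtype.val h)
  have hfin := Finite.of_injective _ hF
  have hcard := Nat.card_le_card_of_injective _ hF
  rw [Nat.card_prod, Nat.card_perm, Nat.card_fin, Nat.card_eq_fintype_card (α := T),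
    Fintype.card_coe] at hcard
  exact ⟨Finite.of_injective (fun ν => (ν, Equiv.refl (Fin N)))
    fun a b h => congrArg Prod.fst h, hcard⟩

lemma finite_chains (n N : ℕ) (P : (Xc →₀ ℕ) → Prop) :
    Finite {ν : Xc →₀ ℕ // chainEndpoint ν = (n, n) ∧ ν.support.card = N ∧ P ν} := by
  refine (finite_chains_and_card_mul_factorial_le
    (Fintype.piFinset fun _ => Finset.Iic (n, n)) fun ν hν _ e => ?_).1
  rw [Fintype.mem_piFinset]
  intro i
  rw [Finset.mem_Iic, ← hν, chainEndpoint_eq_sum, ← sum_edgeTuple ν e fun v => v]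
  exact Finset.single_le_sum (fun j _ => zero_le) (Finset.mem_univ i)

lemma exists_edgeTuple_eq {N : ℕ} {v : Fin N → ℕ × ℕ} (hv : ∀ i, 0 < (v i).1 ∧ 0 < (v i).2)
    (hnp : PairwiseNonparallel v) :
    ∃ (ν : Xc →₀ ℕ) (e : Fin N ≃ ν.support), edgeTuple ν e = v := by
  have hg : ∀ i, 0 < Nat.gcd (v i).1 (v i).2 := fun i => Nat.gcd_pos_of_pos_left _ (hv i).1
  choose a ha using fun i => Nat.gcd_dvd_left (v i).1 (v i).2
  choose b hb using fun i => Nat.gcd_dvd_right (v i).1 (v i).2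
  have hab : ∀ i, Nat.gcd (a i) (b i) = 1 := fun i => by
    have := Nat.gcd_mul_left (Nat.gcd (v i).1 (v i).2) (a i) (b i)
    rw [← ha, ← hb] at this
    exact Nat.eq_of_mul_eq_mul_left (hg i) (by omega)
  let d : Fin N ↪ Xc := ⟨fun i => ⟨(a i, b i), hab i⟩, fun i j hij => by
    by_contra hne
    have h1 : a i = a j := congrArg (fun x : Xc => x.val.1) hij
    have h2 : b i = b j := congrArg (fun x : Xc => x.val.2) hij
    refine hnp i j hne ?_
    calc (v i).1 * (v j).2 = (Nat.gcd (v i).1 (v i).2 * a i) *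
          (Nat.gcd (v j).1 (v j).2 * b j) := by rw [← ha, ← hb]
      _ = (Nat.gcd (v i).1 (v i).2 * b i) * (Nat.gcd (v j).1 (v j).2 * a j) := by
        rw [h1, h2]; ring
      _ = _ := by rw [← ha, ← hb]⟩
  let ν : Xc →₀ ℕ := Finsupp.embDomain d
    (Finsupp.equivFunOnFinite.symm fun i => Nat.gcd (v i).1 (v i).2)
  have hνd : ∀ i, ν (d i) = Nat.gcd (v i).1 (v i).2 := fun i => by
    simp [ν, Finsupp.embDomain_apply_self]
  have hmem : ∀ i, d i ∈ ν.support := fun i => by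
    rw [Finsupp.mem_support_iff, hνd]
    exact (hg i).ne'
  refine ⟨ν, Equiv.ofBijective (fun i => ⟨d i, hmem i⟩) ⟨fun i j h =>
    d.injective (congrArg Subtype.val h), ?_⟩, ?_⟩
  · rintro ⟨x, hx⟩
    rw [Finsupp.support_embDomain, Finset.mem_map] at hx
    obtain ⟨i, -, rfl⟩ := hx
    exact ⟨i, rfl⟩
  · ext i
    · change ν (d i) • a i = _
      rw [hνd, smul_eq_mul, ← ha]
    · change ν (d i) • b i = _
      rw [hνd, smul_eq_mul, ← hb]

open scoped Nat in
lemma card_chainTuples_le (n N : ℕ) : (chainTuples n N).card ≤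
    Nat.card {ν : Xc →₀ ℕ // chainEndpoint ν = (n, n) ∧ ν.support.card = N ∧ True} * N ! := by
  classical
  have := finite_chains n N fun _ => True
  have := Fintype.ofFinite
    {ν : Xc →₀ ℕ // chainEndpoint ν = (n, n) ∧ ν.support.card = N ∧ True}
  have hperm : N ! = Fintype.card (Equiv.Perm (Fin N)) := by
    rw [Fintype.card_perm, Fintype.card_fin]
  rw [Nat.card_eq_fintype_card, hperm, ← Fintype.card_prod, ← Finset.card_univ]
  refine (Finset.card_le_card fun v hv => ?_).trans
    (Finset.card_image_le (f := orderedEdges (n := n) (N := N) (P := fun _ => True)))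
  rw [mem_chainTuples] at hv
  obtain ⟨h1, h2, h3⟩ := hv
  obtain ⟨ν, e, rfl⟩ := exists_edgeTuple_eq h1 h2
  rw [sum_edgeTuple ν e fun v => v, ← chainEndpoint_eq_sum] at h3
  have hcard : ν.support.card = N := by
    rw [← Fintype.card_coe, ← Fintype.card_congr e, Fintype.card_fin]
  refine Finset.mem_image.2 ⟨(⟨ν, h3, hcard, trivial⟩,
    e.trans (ν.support.equivFinOfCardEq hcard)), Finset.mem_univ _, ?_⟩
  ext i : 1
  simp [orderedEdges, edgeTuple]

lemma slopeLt_trans {a b c : Xc} (hab : slopeLt a b) (hbc : slopeLt b c) : slopeLt a c := by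
  unfold slopeLt at *
  have hb : 0 < b.val.1 := Nat.pos_of_mul_pos_left (Nat.zero_lt_of_lt hbc)
  have ha : 0 < a.val.1 := Nat.pos_of_mul_pos_left (Nat.zero_lt_of_lt hab)
  refine Nat.lt_of_mul_lt_mul_left (a := b.val.1) ?_
  calc b.val.1 * (a.val.2 * c.val.1) = a.val.2 * b.val.1 * c.val.1 := by ring
    _ ≤ b.val.2 * a.val.1 * c.val.1 := Nat.mul_le_mul_right _ hab.le
    _ = b.val.2 * c.val.1 * a.val.1 := by ring
    _ < c.val.2 * b.val.1 * a.val.1 := Nat.mul_lt_mul_of_pos_right hbc ha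
    _ = _ := by ring

lemma SortedSupport.pairwise {ν : Xc →₀ ℕ} {xs : List Xc} (h : SortedSupport ν xs) :
    xs.Pairwise slopeLt :=
  have : Trans slopeLt slopeLt slopeLt := ⟨slopeLt_trans⟩
  List.isChain_iff_pairwise.1 h.2

lemma SortedSupport.nodup {ν : Xc →₀ ℕ} {xs : List Xc} (h : SortedSupport ν xs) : xs.Nodup :=
  h.pairwise.imp fun {a b} hab he => by subst he; exact lt_irrefl _ hab

lemma SortedSupport.slope_le {ν : Xc →₀ ℕ} {xs : List Xc} (h : SortedSupport ν xs) {i j : ℕ}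
    (hij : i ≤ j) (hj : j < xs.length) :
    xs[i].val.2 * xs[j].val.1 ≤ xs[j].val.2 * xs[i].val.1 := by
  rcases hij.eq_or_lt with rfl | hij
  · rfl
  · exact (List.pairwise_iff_getElem.1 h.pairwise i j (hij.trans hj) hj hij).le

lemma below_of_slope_le {u : ℝ} (hu : 0 ≤ u) (hu1 : u ≤ 1) {a b : Xc}
    (hab : a.val.2 * b.val.1 ≤ b.val.2 * a.val.1) (hb : (1 - u) * b.val.2 ≤ u * b.val.1) :
    (1 - u) * a.val.2 ≤ u * a.val.1 := by
  have hab' : (a.val.2 : ℝ) * b.val.1 ≤ b.val.2 * a.val.1 := by exact_mod_cast hab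
  rcases Nat.eq_zero_or_pos b.val.1 with h0 | h0
  · have h1 := b.2
    rw [h0, Nat.gcd_zero_left] at h1
    rw [h0, h1] at hb
    have : u = 1 := by push_cast at hb; linarith
    subst this
    rw [sub_self, zero_mul, one_mul]
    positivity
  · have h0' : (0 : ℝ) < b.val.1 := by exact_mod_cast h0
    refine le_of_mul_le_mul_right ?_ h0'
    calc (1 - u) * a.val.2 * b.val.1 = (1 - u) * (a.val.2 * b.val.1) := by ring
      _ ≤ (1 - u) * (b.val.2 * a.val.1) := mul_le_mul_of_nonneg_left hab' (by linarith)
      _ = (1 - u) * b.val.2 * a.val.1 := by ring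
      _ ≤ u * b.val.1 * a.val.1 := mul_le_mul_of_nonneg_right hb (by positivity)
      _ = _ := by ring

lemma fstBelow_smul {u : ℝ} {m : ℕ} (hm : m ≠ 0) (x : ℕ × ℕ) :
    fstBelow u 1 (m • x) = if (1 - u) * x.2 ≤ u * x.1 then ((m * x.1 : ℕ) : ℝ) else 0 := by
  have hm' : (0 : ℝ) < m := by positivity
  have : (1 - u) * ((m • x).2 : ℝ) ≤ u * ((m • x).1 : ℝ) ↔ (1 - u) * x.2 ≤ u * x.1 := by
    rw [Prod.smul_fst, Prod.smul_snd, smul_eq_mul, smul_eq_mul, Nat.cast_mul, Nat.cast_mul,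
      mul_left_comm, mul_left_comm u, mul_le_mul_iff_right₀ hm']
  rw [fstBelow, if_congr this rfl rfl, mul_ite, mul_one, mul_zero, one_mul]
  rfl

lemma sndBelow_smul {u : ℝ} {m : ℕ} (hm : m ≠ 0) (x : ℕ × ℕ) :
    sndBelow u 1 (m • x) = if (1 - u) * x.2 ≤ u * x.1 then ((m * x.2 : ℕ) : ℝ) else 0 := by
  have hm' : (0 : ℝ) < m := by positivity
  have : (1 - u) * ((m • x).2 : ℝ) ≤ u * ((m • x).1 : ℝ) ↔ (1 - u) * x.2 ≤ u * x.1 := by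
    rw [Prod.smul_fst, Prod.smul_snd, smul_eq_mul, smul_eq_mul, Nat.cast_mul, Nat.cast_mul,
      mul_left_comm, mul_left_comm u, mul_le_mul_iff_right₀ hm']
  rw [sndBelow, if_congr this rfl rfl, mul_ite, mul_one, mul_zero, one_mul]
  rfl

lemma SortedSupport.vertexR_eq {ν : Xc →₀ ℕ} {xs : List Xc} (h : SortedSupport ν xs) (i : ℕ) :
    vertexR ν xs i = (∑ x ∈ (xs.take i).toFinset, ((ν x * x.val.1 : ℕ) : ℝ),
      ∑ x ∈ (xs.take i).toFinset, ((ν x * x.val.2 : ℕ) : ℝ)) := by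
  have hnd := h.nodup.sublist (List.take_sublist i xs)
  rw [vertexR, List.sum_toFinset _ hnd, List.sum_toFinset _ hnd]

lemma vertexR_nonneg (ν : Xc →₀ ℕ) (xs : List Xc) (i : ℕ) : 0 ≤ vertexR ν xs i :=
  ⟨List.sum_nonneg fun a ha => by
    obtain ⟨x, -, rfl⟩ := List.mem_map.1 ha
    positivity, List.sum_nonneg fun a ha => by
    obtain ⟨x, -, rfl⟩ := List.mem_map.1 ha
    positivity⟩

lemma SortedSupport.take_subset {ν : Xc →₀ ℕ} {xs : List Xc} (h : SortedSupport ν xs) (i : ℕ) :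
    (xs.take i).toFinset ⊆ ν.support := by
  rw [← h.1]
  intro x hx
  rw [List.mem_toFinset] at hx ⊢
  exact List.mem_of_mem_take hx

lemma sum_take_le {ν : Xc →₀ ℕ} {xs : List Xc} (h : SortedSupport ν xs) {i : ℕ}
    (hi : i < xs.length) {u : ℝ} (hu : 0 ≤ u) (hu1 : u ≤ 1)
    (hx : (1 - u) * xs[i].val.2 ≤ u * xs[i].val.1) (g : Xc → ℕ) :
    ∑ x ∈ (xs.take (i + 1)).toFinset, (g x : ℝ) ≤
      ∑ x ∈ ν.support, if (1 - u) * x.val.2 ≤ u * x.val.1 then (g x : ℝ) else 0 := by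
  rw [← Finset.sum_filter]
  refine Finset.sum_le_sum_of_subset_of_nonneg (fun x hxt => ?_) fun _ _ _ => by positivity
  refine Finset.mem_filter.2 ⟨h.take_subset _ hxt, ?_⟩
  rw [List.mem_toFinset, List.mem_take_iff_getElem] at hxt
  obtain ⟨k, hk, rfl⟩ := hxt
  exact below_of_slope_le hu hu1 (h.slope_le (by omega) hi) hx

lemma le_sum_take {ν : Xc →₀ ℕ} {xs : List Xc} (h : SortedSupport ν xs) {i : ℕ}
    (hi : i < xs.length) {u : ℝ} (hu : 0 ≤ u) (hu1 : u ≤ 1)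
    (hx : ¬ (1 - u) * xs[i].val.2 ≤ u * xs[i].val.1) (g : Xc → ℕ) :
    (∑ x ∈ ν.support, if (1 - u) * x.val.2 ≤ u * x.val.1 then (g x : ℝ) else 0) ≤
      ∑ x ∈ (xs.take i).toFinset, (g x : ℝ) := by
  rw [← Finset.sum_filter]
  refine Finset.sum_le_sum_of_subset_of_nonneg (fun x hxt => ?_) fun _ _ _ => by positivity
  rw [Finset.mem_filter, ← h.1, List.mem_toFinset, List.mem_iff_getElem] at hxt
  obtain ⟨⟨k, hk, rfl⟩, hb⟩ := hxt
  rw [List.mem_toFinset, List.mem_take_iff_getElem]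
  refine ⟨k, ?_, rfl⟩
  rw [lt_min_iff]
  refine ⟨?_, hk⟩
  by_contra! hik
  exact hx (below_of_slope_le hu hu1 (h.slope_le hik hk) hb)

lemma sum_fstBelow_eq (ν : Xc →₀ ℕ) (u : ℝ) : ∑ x ∈ ν.support, fstBelow u 1 (ν x • x.val) =
    ∑ x ∈ ν.support,
      if (1 - u) * x.val.2 ≤ u * x.val.1 then ((ν x * x.val.1 : ℕ) : ℝ) else 0 :=
  Finset.sum_congr rfl fun _ hx => fstBelow_smul (Finsupp.mem_support_iff.1 hx) _

lemma sum_sndBelow_eq (ν : Xc →₀ ℕ) (u : ℝ) : ∑ x ∈ ν.support, sndBelow u 1 (ν x • x.val) =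
    ∑ x ∈ ν.support,
      if (1 - u) * x.val.2 ≤ u * x.val.1 then ((ν x * x.val.2 : ℕ) : ℝ) else 0 :=
  Finset.sum_congr rfl fun _ hx => sndBelow_smul (Finsupp.mem_support_iff.1 hx) _

/-- If the truncated sums of a chain are close to their limits on a grid, then each edge is
located between two close points of the parabola. -/
lemma exists_between_of_close {n K : ℕ} (hK : 0 < K) {ν : Xc →₀ ℕ} {ε : ℝ} (hε : 0 ≤ ε)
    (h1 : ∀ j ≤ K, |∑ x ∈ ν.support, fstBelow (j / K) 1 (ν x • x.val) -
      n * (1 - (1 - (j / K : ℝ)) ^ 2)| ≤ ε * n)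
    (h2 : ∀ j ≤ K, |∑ x ∈ ν.support, sndBelow (j / K) 1 (ν x • x.val) -
      n * (j / K : ℝ) ^ 2| ≤ ε * n)
    {xs : List Xc} (h : SortedSupport ν xs) {i : ℕ} (hi : i < xs.length) :
    ∃ u u' : ℝ, 0 ≤ u ∧ u ≤ u' ∧ u' ≤ u + 1 / K ∧ u' ≤ 1 ∧
      n * (1 - (1 - u) ^ 2) - ε * n ≤ (vertexR ν xs i).1 ∧
      n * u ^ 2 - ε * n ≤ (vertexR ν xs i).2 ∧
      (vertexR ν xs (i + 1)).1 ≤ n * (1 - (1 - u') ^ 2) + ε * n ∧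
      (vertexR ν xs (i + 1)).2 ≤ n * u' ^ 2 + ε * n := by
  classical
  have hK' : (0 : ℝ) < K := by positivity
  have hex : ∃ j : ℕ, (1 - (j / K : ℝ)) * xs[i].val.2 ≤ (j / K : ℝ) * xs[i].val.1 :=
    ⟨K, by rw [div_self hK'.ne', sub_self, zero_mul, one_mul]; positivity⟩
  have hu01 : ∀ j : ℕ, j ≤ K → 0 ≤ (j / K : ℝ) ∧ (j / K : ℝ) ≤ 1 := fun j hj =>
    ⟨by positivity, (div_le_one hK').2 (by exact_mod_cast hj)⟩
  have hjK : Nat.find hex ≤ K :=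
    Nat.find_min' hex (by rw [div_self hK'.ne', sub_self, zero_mul, one_mul]; positivity)
  have hj := Nat.find_spec hex
  have hmin := fun m => Nat.find_min (H := hex) (m := m)
  set j := Nat.find hex with hjdef
  have hup1 := sum_take_le h hi (hu01 j hjK).1 (hu01 j hjK).2 hj fun x => ν x * x.val.1
  have hup2 := sum_take_le h hi (hu01 j hjK).1 (hu01 j hjK).2 hj fun x => ν x * x.val.2
  rw [← sum_fstBelow_eq] at hup1
  rw [← sum_sndBelow_eq] at hup2
  have a1 := (abs_le.1 (h1 j hjK)).2
  have a2 := (abs_le.1 (h2 j hjK)).2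
  have v1 := h.vertexR_eq i
  have v2 := h.vertexR_eq (i + 1)
  have hεn : 0 ≤ ε * n := by positivity
  rcases Nat.eq_zero_or_pos j with h0 | h0
  · refine ⟨(j / K : ℝ), (j / K : ℝ), (hu01 j hjK).1, le_rfl, by
      have : (0 : ℝ) ≤ 1 / K := by positivity
      linarith, (hu01 j hjK).2, ?_, ?_, by rw [v2]; linarith, by rw [v2]; linarith⟩
    · refine le_trans ?_ (vertexR_nonneg ν xs i).1
      rw [h0, Nat.cast_zero, zero_div]
      norm_num
      exact hεn
    · refine le_trans ?_ (vertexR_nonneg ν xs i).2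
      rw [h0, Nat.cast_zero, zero_div]
      norm_num
      exact hεn
  · obtain ⟨m, hm⟩ := Nat.exists_eq_succ_of_ne_zero h0.ne'
    have hmK : m ≤ K := by omega
    have hnot := hmin m (by omega)
    have hlo1 := le_sum_take h hi (hu01 m hmK).1 (hu01 m hmK).2 hnot fun x => ν x * x.val.1
    have hlo2 := le_sum_take h hi (hu01 m hmK).1 (hu01 m hmK).2 hnot fun x => ν x * x.val.2
    rw [← sum_fstBelow_eq] at hlo1
    rw [← sum_sndBelow_eq] at hlo2
    have b1 := (abs_le.1 (h1 m hmK)).1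
    have b2 := (abs_le.1 (h2 m hmK)).1
    have hjm : (j / K : ℝ) = m / K + 1 / K := by rw [hm]; push_cast; ring
    refine ⟨(m / K : ℝ), (j / K : ℝ), (hu01 m hmK).1, ?_, hjm.le, (hu01 j hjK).2,
      by rw [v1]; linarith, by rw [v1]; linarith, by rw [v2]; linarith, by rw [v2]; linarith⟩
    rw [hjm]
    have : (0 : ℝ) ≤ 1 / K := by positivity
    linarith

lemma abs_sub_parab_le {p q u u' e : ℝ} (hp : 0 ≤ p) (hu : 0 ≤ u) (huu : u ≤ u') (hu1 : u' ≤ 1)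
    (he : 0 ≤ e) (hp1 : 1 - (1 - u) ^ 2 - e ^ 2 ≤ p) (hp2 : p ≤ 1 - (1 - u') ^ 2 + e ^ 2)
    (hq1 : u ^ 2 - e ^ 2 ≤ q) (hq2 : q ≤ u' ^ 2 + e ^ 2) :
    |q - parab p| ≤ 2 * (u' - u) + e ^ 2 + 2 * e := by
  unfold parab
  set r := Real.sqrt (1 - p) with hr
  have hr0 : 0 ≤ r := Real.sqrt_nonneg _
  have hr1 : r ≤ 1 := Real.sqrt_le_one.2 (by linarith)
  have hru : r ≤ 1 - u + e := by
    rw [hr]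
    refine Real.sqrt_le_iff.2 ⟨by linarith, ?_⟩
    have := mul_nonneg (show 0 ≤ 1 - u by linarith) he
    linarith [show (1 - u + e) ^ 2 = (1 - u) ^ 2 + 2 * ((1 - u) * e) + e ^ 2 by ring]
  have hru' : 1 - u' - e ≤ r := by
    rcases le_total (1 - u') e with h | h
    · linarith
    · refine Real.le_sqrt_of_sq_le ?_
      have := mul_le_mul_of_nonneg_right h he
      linarith [show (1 - u' - e) ^ 2 = (1 - u') ^ 2 - 2 * ((1 - u') * e) + e * e by ring,
        sq e]
  have h3 : (u' - u) * (u' + u) ≤ (u' - u) * 2 :=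
    mul_le_mul_of_nonneg_left (by linarith) (by linarith)
  have h4 : (1 - r) ^ 2 ≤ u' ^ 2 + 2 * e := by
    rcases le_total (1 - r) u' with h | h
    · have : (1 - r) ^ 2 ≤ u' ^ 2 := pow_le_pow_left₀ (by linarith) h 2
      linarith
    · have : (1 - r - u') * (1 - r + u') ≤ e * 2 :=
        mul_le_mul (by linarith) (by linarith) (by linarith) he
      linarith [show (1 - r - u') * (1 - r + u') = (1 - r) ^ 2 - u' ^ 2 by ring]
  have h5 : u ^ 2 - 2 * e ≤ (1 - r) ^ 2 := by
    rcases le_total u (1 - r) with h | h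
    · have : u ^ 2 ≤ (1 - r) ^ 2 := pow_le_pow_left₀ hu h 2
      linarith
    · have : (u - (1 - r)) * (u + (1 - r)) ≤ e * 2 :=
        mul_le_mul (by linarith) (by linarith) (by linarith) he
      linarith [show (u - (1 - r)) * (u + (1 - r)) = u ^ 2 - (1 - r) ^ 2 by ring]
  have h6 : (u' - u) * (u' + u) = u' ^ 2 - u ^ 2 := by ring
  rw [abs_le]
  constructor <;> linarith

lemma goodParab_of_close {n K : ℕ} (hn : 0 < n) (hK : 0 < K) {ν : Xc →₀ ℕ} {e δ : ℝ}
    (he : 0 ≤ e) (hδ : 2 / K + e ^ 2 + 2 * e ≤ δ)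
    (h1 : ∀ j ≤ K, |∑ x ∈ ν.support, fstBelow (j / K) 1 (ν x • x.val) -
      n * (1 - (1 - (j / K : ℝ)) ^ 2)| ≤ e ^ 2 * n)
    (h2 : ∀ j ≤ K, |∑ x ∈ ν.support, sndBelow (j / K) 1 (ν x • x.val) -
      n * (j / K : ℝ) ^ 2| ≤ e ^ 2 * n) : GoodParab n δ ν := by
  intro xs h i hi P hP
  obtain ⟨u, u', hu, huu, hK1, hu1, l1, l2, r1, r2⟩ :=
    exists_between_of_close hK (sq_nonneg e) h1 h2 h hi
  have hn' : (0 : ℝ) < n := by exact_mod_cast hn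
  have hsub : (xs.take i).toFinset ⊆ (xs.take (i + 1)).toFinset := fun x hx => by
    rw [List.mem_toFinset] at hx ⊢
    exact (List.take_subset_take_left xs (Nat.le_succ i)) hx
  have hle : vertexR ν xs i ≤ vertexR ν xs (i + 1) := by
    rw [h.vertexR_eq, h.vertexR_eq]
    exact ⟨Finset.sum_le_sum_of_subset_of_nonneg hsub fun _ _ _ => by positivity,
      Finset.sum_le_sum_of_subset_of_nonneg hsub fun _ _ _ => by positivity⟩
  have hV0 : 0 ≤ (vertexR ν xs i).1 := (vertexR_nonneg ν xs i).1
  obtain ⟨⟨p1, p2⟩, q1, q2⟩ := segment_subset_Icc hle hP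
  have key := abs_sub_parab_le (p := P.1 / n) (q := P.2 / n) (div_nonneg (hV0.trans p1) hn'.le)
    hu huu hu1 he ((le_div_iff₀ hn').2 (by linarith)) ((div_le_iff₀ hn').2 (by linarith))
    ((le_div_iff₀ hn').2 (by linarith)) ((div_le_iff₀ hn').2 (by linarith))
  calc |P.2 - n * parab (P.1 / n)| = |P.2 / n - parab (P.1 / n)| * n := by
        rw [← abs_of_pos hn', ← abs_mul, abs_of_pos hn', sub_mul, div_mul_cancel₀ _ hn'.ne',
          mul_comm (n : ℝ)]
    _ ≤ δ * n := by
      refine mul_le_mul_of_nonneg_right (key.trans ?_) hn'.le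
      have : 2 * (1 / (K : ℝ)) = 2 / K := by ring
      linarith

lemma fstBelow_eq_mul (u h : ℝ) (v : ℕ × ℕ) : fstBelow u h v = h * fstBelow u 1 v := by
  unfold fstBelow
  ring

lemma sndBelow_eq_mul (u h : ℝ) (v : ℕ × ℕ) : sndBelow u h v = h * sndBelow u 1 v := by
  unfold sndBelow
  ring

lemma scaled_deviation_ge {h n N η ε μ x : ℝ} (hh : 0 < h) (hN : 0 ≤ N) (hη : 0 ≤ η)
    (hηε : η ≤ ε / 4) (hhn : h * n = (1 + η) * N) (hμ0 : 0 ≤ μ) (hμ1 : μ ≤ 1)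
    (hx : ε * n < |x - n * μ|) : N * (ε / 2) ≤ |h * x - N * μ| := by
  have e1 : h * (ε * n) ≤ h * |x - n * μ| := mul_le_mul_of_nonneg_left hx.le hh.le
  have e2 : h * |x - n * μ| = |(h * x - N * μ) - η * N * μ| := by
    rw [← abs_of_pos hh, ← abs_mul, abs_of_pos hh]
    congr 1
    linear_combination (-μ) * hhn
  have e3 := abs_sub (h * x - N * μ) (η * N * μ)
  have e4 : |η * N * μ| ≤ η * N := by
    rw [abs_of_nonneg (by positivity)]
    exact mul_le_of_le_one_right (by positivity) hμ1
  have e5 : η * N ≤ ε / 4 * N := mul_le_mul_of_nonneg_right hηε hN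
  have e6 : ε * N ≤ h * (ε * n) := by
    have : 0 ≤ ε * (η * N) := mul_nonneg (by linarith) (by positivity)
    calc ε * N ≤ ε * N + ε * (η * N) := by linarith
      _ = ε * ((1 + η) * N) := by ring
      _ = _ := by rw [← hhn]; ring
  have e7 : 0 ≤ ε * N := mul_nonneg (by linarith) hN
  linarith

open scoped Nat in
/-- Chains far from the parabola are exponentially rare in the geometric weighting. -/
lemma card_not_goodParab_le {δ : ℝ} (hδ : 0 < δ) :
    ∃ c > 0, ∃ C > 0, ∃ h₀ > 0, ∃ η₀ > 0, ∀ η : ℝ, 0 < η → η ≤ η₀ → ∀ (n N : ℕ) (h : ℝ), 0 < n →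
      0 < h → h < h₀ → h * n = (1 + η) * N →
      (Nat.card {ν : Xc →₀ ℕ // chainEndpoint ν = (n, n) ∧ ν.support.card = N ∧
        ¬ GoodParab n δ ν} * N ! : ℝ) ≤
        C * exp (2 * (1 + η) * N - c * N) * totalWeight h ^ N := by
  classical
  obtain ⟨K, hK⟩ := exists_nat_gt (4 / δ)
  have hK0 : (0 : ℝ) < K := lt_trans (by positivity) hK
  have hKpos : 0 < K := by exact_mod_cast hK0
  set e := min 1 (δ / 6) with he
  have he0 : 0 < e := by positivity
  have he1 : e ≤ 1 := min_le_left _ _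
  have heδ : e ≤ δ / 6 := min_le_right _ _
  have hδ' : 2 / K + e ^ 2 + 2 * e ≤ δ := by
    have h1 : 2 / (K : ℝ) ≤ δ / 2 := by
      rw [div_lt_iff₀ hδ] at hK
      rw [div_le_iff₀ hK0]
      linarith
    have h2 : e ^ 2 ≤ e := by rw [sq]; exact mul_le_of_le_one_right he0.le he1
    linarith
  let f : Bool × ℕ → ℝ → ℕ × ℕ → ℝ := fun p => cond p.1 (fstBelow (p.2 / K)) (sndBelow (p.2 / K))
  let μ : Bool × ℕ → ℝ := fun p => cond p.1 (1 - (1 - (p.2 / K : ℝ)) ^ 2) ((p.2 / K : ℝ) ^ 2)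
  have hu01 : ∀ j : ℕ, j ≤ K → 0 ≤ (j / K : ℝ) ∧ (j / K : ℝ) ≤ 1 := fun j hj =>
    ⟨by positivity, (div_le_one hK0).2 (by exact_mod_cast hj)⟩
  set s : Finset (Bool × ℕ) := Finset.univ ×ˢ Finset.range (K + 1) with hs
  have hmem : ∀ b j, (b, j) ∈ s ↔ j ≤ K := fun b j => by simp [hs]
  obtain ⟨c, hc, h₀, hh₀, H⟩ := HasGeomMean.abs_tail_finset (f := f) (μ := μ) s (by
    rintro ⟨b, j⟩ hj
    obtain ⟨hj0, hj1⟩ := hu01 j ((hmem b j).1 hj)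
    cases b
    · exact hasGeomMean_sndBelow hj0 hj1
    · exact hasGeomMean_fstBelow hj0 hj1) (ε := e ^ 2 / 2) (by positivity)
  refine ⟨c, hc, 2 * (s.card + 1), by positivity, h₀, hh₀, e ^ 2 / 4, by positivity,
    fun η hη hηe n N h hn hh hhlt hhn => ?_⟩
  set T : Finset (Fin N → ℕ × ℕ) := (Fintype.piFinset fun _ => Finset.Iic (n, n)).filter fun v =>
    ∑ i, v i = (n, n) ∧ ∃ p ∈ s, N * (e ^ 2 / 2) ≤ |∑ i, f p h (v i) - N * μ p| with hT
  have hcard := (finite_chains_and_card_mul_factorial_le (n := n) (N := N)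
    (P := fun ν => ¬ GoodParab n δ ν) T fun ν hν hbad E => by
      have hsum : ∑ i, edgeTuple ν E i = (n, n) := by
        rw [← hν, chainEndpoint_eq_sum, ← sum_edgeTuple ν E fun v => v]
      rw [hT, Finset.mem_filter, Fintype.mem_piFinset]
      refine ⟨fun i => ?_, hsum, ?_⟩
      · rw [Finset.mem_Iic, ← hsum]
        exact Finset.single_le_sum (fun j _ => zero_le) (Finset.mem_univ i)
      · by_contra! hcon
        refine hbad (goodParab_of_close hn hKpos he0.le hδ' (fun j hj => ?_) fun j hj => ?_)
        · have h1 := hcon (true, j) ((hmem _ _).2 hj)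
          contrapose! h1
          obtain ⟨hj0, hj1⟩ := hu01 j hj
          have := scaled_deviation_ge hh (Nat.cast_nonneg N) hη.le hηe hhn
            (by nlinarith) (by nlinarith) h1
          refine this.trans_eq ?_
          change _ = |∑ i, fstBelow (j / K) h (edgeTuple ν E i) - N * (1 - (1 - (j / K : ℝ)) ^ 2)|
          rw [sum_edgeTuple ν E (fstBelow (j / K) h), Finset.mul_sum]
          simp only [fstBelow_eq_mul _ h]
        · have h1 := hcon (false, j) ((hmem _ _).2 hj)
          contrapose! h1
          obtain ⟨hj0, hj1⟩ := hu01 j hj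
          have := scaled_deviation_ge hh (Nat.cast_nonneg N) hη.le hηe hhn
            (by positivity) (pow_le_one₀ hj0 hj1) h1
          refine this.trans_eq ?_
          change _ = |∑ i, sndBelow (j / K) h (edgeTuple ν E i) - N * (j / K : ℝ) ^ 2|
          rw [sum_edgeTuple ν E (sndBelow (j / K) h), Finset.mul_sum]
          simp only [sndBelow_eq_mul _ h]).2
  have hcard' : (Nat.card {ν : Xc →₀ ℕ // chainEndpoint ν = (n, n) ∧ ν.support.card = N ∧
        ¬ GoodParab n δ ν} * N ! : ℝ) ≤ T.card := by exact_mod_cast hcard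
  refine hcard'.trans ?_
  have hw := H h hh hhlt N T fun v hv => (Finset.mem_filter.1 hv).2.2
  have hprod : ∀ v ∈ T, ∏ i, geomWeight h (v i) = exp (-(2 * (1 + η) * N)) := fun v hv => by
    have hv := (Finset.mem_filter.1 hv).2.1
    have h1 : ∑ i, ((v i).1 : ℝ) = n := by
      have := congrArg Prod.fst hv
      rw [Prod.fst_sum] at this
      exact_mod_cast this
    have h2 : ∑ i, ((v i).2 : ℝ) = n := by
      have := congrArg Prod.snd hv
      rw [Prod.snd_sum] at this
      exact_mod_cast this
    rw [prod_geomWeight, ← Finset.mul_sum, ← Finset.mul_sum, h1, h2, hhn]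
    congr 1
    ring
  rw [Finset.sum_congr rfl hprod, Finset.sum_const, nsmul_eq_mul, exp_neg,
    ← div_eq_mul_inv, div_le_iff₀ (exp_pos _)] at hw
  refine hw.trans ?_
  have hS := totalWeight_pos hh
  have hP : 0 ≤ exp (2 * (1 + η) * N - c * N) * totalWeight h ^ N := by positivity
  calc _ = 2 * s.card * (exp (2 * (1 + η) * N - c * N) * totalWeight h ^ N) := by
        rw [sub_eq_add_neg, exp_add, neg_mul]; ring
    _ ≤ 2 * (s.card + 1) * (exp (2 * (1 + η) * N - c * N) * totalWeight h ^ N) :=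
        mul_le_mul_of_nonneg_right (by linarith) hP
    _ = _ := by ring

open scoped Nat in
/-- Lower bound for the number of chains with few vertices. -/
lemma card_chains_ge {η : ℝ} (hη : 0 < η) : ∃ h₀ > 0, ∃ σ > 0, ∃ k₀ : ℕ, ∀ (n k : ℕ) (h : ℝ),
    0 < h → h < h₀ → k₀ ≤ k → k ≤ σ / h ^ 2 → h * n = (1 + η) * (k + 2 : ℕ) →
      1 / 2 * exp (2 * k - 2 * η * k) * totalWeight h ^ k ≤
        (Nat.card {ν : Xc →₀ ℕ // chainEndpoint ν = (n, n) ∧ ν.support.card = k + 2 ∧ True} *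
          (k + 2)! : ℝ) := by
  obtain ⟨h₀, hh₀, σ, hσ, k₀, H⟩ := exists_many_nonparallel (half_pos hη)
  refine ⟨min h₀ (η / 4), by positivity, σ, hσ, k₀, fun n k h hh hhlt hk hkσ hhn => ?_⟩
  rw [lt_min_iff] at hhlt
  obtain ⟨T, hT, hTc⟩ := H h hh hhlt.1 k hk hkσ
  push_cast at hhn
  have hbound : ∀ a : ℕ, h * a ≤ k * (1 + η / 2) → a + (2 * k + 3) ≤ n := fun a ha => by
    have h1 : h * (2 * k + 3) ≤ η / 4 * (2 * k + 3) :=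
      mul_le_mul_of_nonneg_right hhlt.2.le (by positivity)
    have h2 : h * (a + (2 * k + 3)) ≤ h * n := by
      rw [mul_add, hhn]
      linarith
    have h3 := le_of_mul_le_mul_left h2 hh
    exact_mod_cast h3
  have h1 := card_le_card_chainTuples T fun v hv => by
    obtain ⟨h1, h2, h3, h4⟩ := hT v hv
    refine ⟨h1, h2, hbound _ ?_, hbound _ ?_⟩
    · rw [← Finset.mul_sum] at h3
      exact_mod_cast h3
    · rw [← Finset.mul_sum] at h4
      exact_mod_cast h4
  have h2 : (T.card : ℝ) ≤
      (Nat.card {ν : Xc →₀ ℕ // chainEndpoint ν = (n, n) ∧ ν.support.card = k + 2 ∧ True} *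
          (k + 2)! : ℝ) := by
    exact_mod_cast h1.trans (card_chainTuples_le n (k + 2))
  refine le_trans ?_ (hTc.trans h2)
  have hS := totalWeight_pos hh
  have h3 : exp (2 * k - 2 * η * k) ≤ exp (2 * k * (1 - η / 2)) * exp (-(η / 2) * k) := by
    rw [← exp_add, exp_le_exp]
    have : 0 ≤ η * k := by positivity
    linarith
  have h4 := mul_le_mul_of_nonneg_right h3 (show 0 ≤ 1 / 2 * totalWeight h ^ k by positivity)
  linarith

/-- In the relevant range of parameters, a chain is unlikely to be far from the parabola. -/
lemma card_not_goodParab_le_mul {δ : ℝ} (hδ : 0 < δ) :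
    ∃ c > 0, ∃ C > 0, ∃ r > 0, ∃ σ > 0, ∃ N₀ : ℕ, ∀ n N : ℕ, 0 < n → N₀ ≤ N →
      (N : ℝ) / n < r → (N : ℝ) ^ 3 / n ^ 2 ≤ σ →
      0 < Nat.card {ν : Xc →₀ ℕ // chainEndpoint ν = (n, n) ∧ ν.support.card = N ∧ True} ∧
      (Nat.card {ν : Xc →₀ ℕ // chainEndpoint ν = (n, n) ∧ ν.support.card = N ∧
        ¬ GoodParab n δ ν} : ℝ) ≤ C * (n ^ 4 * exp (-c * N)) *
      Nat.card {ν : Xc →₀ ℕ // chainEndpoint ν = (n, n) ∧ ν.support.card = N ∧ True} := by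
  obtain ⟨c, hc, C, hC, h₁, hh₁, η₀, hη₀, H₁⟩ := card_not_goodParab_le hδ
  set η := min (min η₀ 1) (c / 8) with hη
  have hη0 : 0 < η := by positivity
  have hη1 : η ≤ 1 := (min_le_left _ _).trans (min_le_right _ _)
  have hηη : η ≤ η₀ := (min_le_left _ _).trans (min_le_left _ _)
  have hηc : η ≤ c / 8 := min_le_right _ _
  obtain ⟨h₂, hh₂, σ, hσ, k₀, H₂⟩ := card_chains_ge hη0
  refine ⟨c / 2, by positivity, 32 * C * exp 4, by positivity, min (min h₁ h₂) 1 / 2,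
    by positivity, σ / 4, by positivity, k₀ + 2, fun n N hn hN hNr hNσ => ?_⟩
  obtain ⟨k, rfl⟩ : ∃ k, N = k + 2 := ⟨N - 2, by omega⟩
  have hn' : (0 : ℝ) < n := by exact_mod_cast hn
  set M : ℝ := ((k + 2 : ℕ) : ℝ) with hM
  have hMk : M = k + 2 := by rw [hM]; push_cast; ring
  have hM1 : 1 ≤ M := by rw [hMk]; linarith [Nat.cast_nonneg (α := ℝ) k]
  set h : ℝ := (1 + η) * M / n with hh
  have hh0 : 0 < h := by positivity
  have hhn : h * n = (1 + η) * M := div_mul_cancel₀ _ hn'.ne'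
  have hh2 : h ≤ 2 * (M / n) := by
    rw [hh, mul_div_assoc]
    exact mul_le_mul_of_nonneg_right (by linarith) (by positivity)
  have hhlt : h < min (min h₁ h₂) 1 := by linarith
  rw [lt_min_iff, lt_min_iff] at hhlt
  have hkσ : (k : ℝ) ≤ σ / h ^ 2 := by
    rw [le_div_iff₀ (by positivity)]
    calc (k : ℝ) * h ^ 2 ≤ M * (2 * (M / n)) ^ 2 :=
          mul_le_mul (by linarith) (pow_le_pow_left₀ hh0.le hh2 2) (by positivity) (by positivity)
      _ = 4 * (M ^ 3 / n ^ 2) := by ring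
      _ ≤ σ := by linarith
  have hup := H₁ η hη0 hηη n (k + 2) h hn hh0 hhlt.1.1 hhn
  have hlow := H₂ n k h hh0 hhlt.1.2 (by omega) hkσ hhn
  have hS := totalWeight_pos hh0
  have hSn : totalWeight h ≤ 4 * n ^ 2 := by
    refine (totalWeight_le hh0 hhlt.2.le).trans ?_
    rw [div_le_iff₀ (by positivity)]
    have h1 : 1 ≤ h * n := by
      rw [hhn]
      have : 0 ≤ η * M := by positivity
      linarith
    have h2 : 1 ≤ (h * n) ^ 2 := one_le_pow₀ h1
    linarith [show (h * n) ^ 2 = n ^ 2 * h ^ 2 by ring]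
  have hf : (0 : ℝ) < Nat.factorial (k + 2) := by exact_mod_cast Nat.factorial_pos _
  set A : ℝ := (Nat.card {ν : Xc →₀ ℕ // chainEndpoint ν = (n, n) ∧ ν.support.card = k + 2 ∧
    ¬ GoodParab n δ ν} : ℝ)
  have hexp : exp (2 * (1 + η) * M - c * M) ≤
      exp 4 * exp (-(c / 2) * M) * exp (2 * k - 2 * η * k) := by
    rw [← exp_add, ← exp_add, exp_le_exp]
    have h1 : η * M ≤ c / 8 * M := mul_le_mul_of_nonneg_right hηc (by positivity)
    have h2 : η * k ≤ η * M := mul_le_mul_of_nonneg_left (by linarith) hη0.le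
    linarith
  have hS2 : totalWeight h ^ (k + 2) ≤ 16 * n ^ 4 * totalWeight h ^ k := by
    have h1 : totalWeight h ^ 2 ≤ (4 * n ^ 2) ^ 2 := pow_le_pow_left₀ hS.le hSn 2
    have h2 := mul_le_mul_of_nonneg_left h1 (show 0 ≤ totalWeight h ^ k by positivity)
    rw [pow_add]
    linarith [show totalWeight h ^ k * (4 * (n : ℝ) ^ 2) ^ 2 =
      16 * n ^ 4 * totalWeight h ^ k by ring]
  have hpos : 0 < 1 / 2 * exp (2 * k - 2 * η * k) * totalWeight h ^ k := by positivity
  refine ⟨?_, le_of_mul_le_mul_right ?_ hf⟩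
  · have h1 := pos_of_mul_pos_left (hpos.trans_le hlow) hf.le
    exact_mod_cast h1
  · calc A * Nat.factorial (k + 2) ≤
          C * exp (2 * (1 + η) * M - c * M) * totalWeight h ^ (k + 2) := hup
      _ ≤ C * (exp 4 * exp (-(c / 2) * M) * exp (2 * k - 2 * η * k)) *
          (16 * n ^ 4 * totalWeight h ^ k) :=
        mul_le_mul (mul_le_mul_of_nonneg_left hexp hC.le) hS2 (by positivity) (by positivity)
      _ = 32 * C * exp 4 * (n ^ 4 * exp (-(c / 2) * M)) *
          (1 / 2 * exp (2 * k - 2 * η * k) * totalWeight h ^ k) := by ring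
      _ ≤ _ := by
        rw [mul_assoc (32 * C * exp 4 * (n ^ 4 * exp (-(c / 2) * M)))]
        exact mul_le_mul_of_nonneg_left hlow (by positivity)

lemma tendsto_natFloor_mul_rpow {c s : ℝ} (hc : 0 < c) (hs : 0 < s) :
    Tendsto (fun n : ℕ => ⌊c * (n : ℝ) ^ s⌋₊) atTop atTop :=
  tendsto_nat_floor_atTop.comp
    (((tendsto_rpow_atTop hs).comp tendsto_natCast_atTop_atTop).const_mul_atTop hc)

lemma tendsto_natFloor_pow_div_pow {c s : ℝ} (hc : 0 < c) {a b : ℕ} (hs : s * a < b) :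
    Tendsto (fun n : ℕ => (⌊c * (n : ℝ) ^ s⌋₊ : ℝ) ^ a / (n : ℝ) ^ b) atTop (nhds 0) := by
  have h1 : Tendsto (fun n : ℕ => c ^ a * (n : ℝ) ^ (-(b - s * a))) atTop (nhds 0) := by
    rw [← mul_zero (c ^ a)]
    exact ((tendsto_rpow_neg_atTop (sub_pos.2 hs)).comp tendsto_natCast_atTop_atTop).const_mul _
  refine squeeze_zero' (Eventually.of_forall fun n => by positivity) ?_ h1
  filter_upwards [eventually_gt_atTop 0] with n hn
  have hn' : (0 : ℝ) < n := by exact_mod_cast hn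
  calc (⌊c * (n : ℝ) ^ s⌋₊ : ℝ) ^ a / (n : ℝ) ^ b ≤ (c * (n : ℝ) ^ s) ^ a / (n : ℝ) ^ b := by
        gcongr
        exact Nat.floor_le (by positivity)
    _ = c ^ a * (n : ℝ) ^ (-(b - s * a)) := by
        rw [mul_pow, ← rpow_mul_natCast hn'.le, neg_sub, rpow_sub hn', rpow_natCast,
          mul_div_assoc]

lemma tendsto_pow_mul_exp_neg_natFloor {c s a : ℝ} (hc : 0 < c) (hs : 0 < s) (ha : 0 < a)
    (m : ℕ) : Tendsto (fun n : ℕ => (n : ℝ) ^ m * exp (-a * ⌊c * (n : ℝ) ^ s⌋₊)) atTop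
      (nhds 0) := by
  have h1 : Tendsto (fun n : ℕ => exp a * (((n : ℝ) ^ s) ^ ((m : ℝ) / s) *
      exp (-(a * c) * (n : ℝ) ^ s))) atTop (nhds 0) := by
    rw [← mul_zero (exp a)]
    exact ((tendsto_rpow_mul_exp_neg_mul_atTop_nhds_zero _ _ (mul_pos ha hc)).comp
      ((tendsto_rpow_atTop hs).comp tendsto_natCast_atTop_atTop)).const_mul _
  refine squeeze_zero (fun n => by positivity) (fun n => ?_) h1
  rw [← rpow_mul (Nat.cast_nonneg n), mul_div_cancel₀ _ hs.ne', rpow_natCast, mul_left_comm,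
    ← exp_add]
  refine mul_le_mul_of_nonneg_left (exp_le_exp.2 ?_) (by positivity)
  have := mul_le_mul_of_nonneg_left (Nat.lt_floor_add_one (c * (n : ℝ) ^ s)).le ha.le
  linarith

lemma card_goodParab_add_card_not (n N : ℕ) (δ : ℝ) :
    Nat.card {ν : Xc →₀ ℕ // chainEndpoint ν = (n, n) ∧ ν.support.card = N ∧ GoodParab n δ ν} +
    Nat.card {ν : Xc →₀ ℕ // chainEndpoint ν = (n, n) ∧ ν.support.card = N ∧
      ¬ GoodParab n δ ν} =
    Nat.card {ν : Xc →₀ ℕ // chainEndpoint ν = (n, n) ∧ ν.support.card = N ∧ True} := by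
  classical
  have := finite_chains n N fun ν => GoodParab n δ ν
  have := finite_chains n N fun ν => ¬ GoodParab n δ ν
  rw [← Nat.card_sum]
  refine Nat.card_congr ((subtypeOrEquiv _ _ ?_).symm.trans (Equiv.subtypeEquivRight fun ν => ?_))
  · rw [Pi.disjoint_iff]
    intro ν
    rw [Prop.disjoint_iff]
    tauto
  · tauto

/-- Limit shape of chains with few vertices: for `c > 0`, `s ∈ (0,2/3)` and `δ > 0`, the
proportion of chains in `Π(n,n,⌊c·n^s⌋)` contained in the `δ,n`-neighborhood of the arc of
parabola `√y = 1 − √(1−x)` tends to `1`. -/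
theorem statement9 (c s δ : ℝ) (hc : 0 < c) (hs : s ∈ Set.Ioo (0:ℝ) (2/3)) (hδ : 0 < δ) :
    Tendsto (fun n : ℕ =>
        (Nat.card {ν : Xc →₀ ℕ // chainEndpoint ν = (n, n) ∧
            ν.support.card = ⌊c * (n : ℝ) ^ s⌋₊ ∧ GoodParab n δ ν} : ℝ)
          / (Nat.card {ν : Xc →₀ ℕ // chainEndpoint ν = (n, n) ∧
              ν.support.card = ⌊c * (n : ℝ) ^ s⌋₊} : ℝ))
      atTop (nhds 1) := by
  obtain ⟨c₁, hc₁, C, hC, r, hr, σ, hσ, N₀, H⟩ := card_not_goodParab_le_mul hδ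
  have hs3 : s * (3 : ℕ) < (2 : ℕ) := by push_cast; linarith [hs.2]
  have hs1 : s * (1 : ℕ) < (1 : ℕ) := by push_cast; linarith [hs.2]
  have hE : Tendsto (fun n : ℕ => 1 - C * ((n : ℝ) ^ 4 * exp (-c₁ * ⌊c * (n : ℝ) ^ s⌋₊))) atTop
      (nhds 1) := by
    have := ((tendsto_pow_mul_exp_neg_natFloor hc hs.1 hc₁ 4).const_mul C).const_sub 1
    rwa [mul_zero, sub_zero] at this
  have hev : ∀ᶠ n : ℕ in atTop, 0 < n ∧ N₀ ≤ ⌊c * (n : ℝ) ^ s⌋₊ ∧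
      (⌊c * (n : ℝ) ^ s⌋₊ : ℝ) / n < r ∧ (⌊c * (n : ℝ) ^ s⌋₊ : ℝ) ^ 3 / n ^ 2 ≤ σ := by
    filter_upwards [eventually_gt_atTop 0,
      (tendsto_natFloor_mul_rpow hc hs.1).eventually_ge_atTop N₀,
      (tendsto_natFloor_pow_div_pow hc hs1).eventually_lt_const hr,
      (tendsto_natFloor_pow_div_pow hc hs3).eventually_le_const hσ] with n h1 h2 h3 h4
    rw [pow_one, pow_one] at h3
    exact ⟨h1, h2, h3, h4⟩
  refine tendsto_of_tendsto_of_tendsto_of_le_of_le' hE tendsto_const_nhds ?_ ?_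
  all_goals
    filter_upwards [hev] with n ⟨h1, h2, h3, h4⟩
    obtain ⟨hpos, hbad⟩ := H n _ h1 h2 h3 h4
    have hsum := card_goodParab_add_card_not n ⌊c * (n : ℝ) ^ s⌋₊ δ
    simp only [and_true] at hpos hbad hsum
    have hpos' : (0 : ℝ) < Nat.card {ν : Xc →₀ ℕ // chainEndpoint ν = (n, n) ∧
      ν.support.card = ⌊c * (n : ℝ) ^ s⌋₊} := by exact_mod_cast hpos
  · rw [le_div_iff₀ hpos']
    have hsum' := congrArg (Nat.cast (R := ℝ)) hsum
    push_cast at hsum'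
    linarith
  · rw [div_le_one hpos']
    exact_mod_cast hsum ▸ Nat.le_add_right _ _
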